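/- arXiv:2405.18815 — 4 statements merged into one kernel-verified Lean document; each statement's English description precedes it below -/
import Mathlib

section
/- Let G be a finite simple graph with no isolated vertices, and for a vertex v let d_v denote its degree in G. Then the number of independent sets of G satisfies i(G) ≤ ∏_{uv ∈ E(G)} i(K_{d_u,d_v})^{1/(d_u d_v)} = ∏_{uv ∈ E(G)} (2^{d_u} + 2^{d_v} − 1)^{1/(d_u d_v)}, where the product is over the edges of G. Moreover, equality holds if and only if G is a disjoint union of complete bipartite graphs (i.e., every connected component of G is a complete bipartite graph). -/
open Finset
open scoped Classical

/-- The number of independent sets of a finite simple graph `G`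
(including the empty set). -/
noncomputable def numIndepSets {V : Type*} [Fintype V] (G : SimpleGraph V) : ℕ :=
  (Finset.univ.filter fun S : Finset V => ∀ u ∈ S, ∀ v ∈ S, ¬ G.Adj u v).card

/-- The weight `(2^{d_u} + 2^{d_v} - 1)^{1/(d_u d_v)} = i(K_{d_u,d_v})^{1/(d_u d_v)}`
attached to the edge `uv`, as a symmetric function on `Sym2 V`. -/
noncomputable def edgeWeight {V : Type*} [Fintype V] (G : SimpleGraph V) : Sym2 V → ℝ :=
  Sym2.lift ⟨fun u v =>
      ((2:ℝ) ^ G.degree u + (2:ℝ) ^ G.degree v - 1) ^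
        ((1:ℝ) / ((G.degree u : ℝ) * (G.degree v : ℝ))),
    fun u v => by
      simp only []
      rw [add_comm ((2:ℝ) ^ G.degree u), mul_comm ((G.degree u : ℝ))]⟩

/-- `G` is a disjoint union of complete bipartite graphs: every connected component of `G`
(as an induced subgraph) is isomorphic to a complete bipartite graph. -/
def IsDisjUnionCompleteBipartite {V : Type*} (G : SimpleGraph V) : Prop :=
  ∀ C : G.ConnectedComponent,
    ∃ a b : ℕ, Nonempty
      ((G.induce {v | G.connectedComponentMk v = C}) ≃g completeBipartiteGraph (Fin a) (Fin b))

theorem add_pow_le_weighted {α β x z : ℝ} (hα : 0 ≤ α) (hβ : 0 < β) (hx : 0 ≤ x) (hz : 0 ≤ z)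
    (k : ℕ) :
    (α * x + β * z) ^ (k + 1) ≤ (α + β) ^ k * (α * x ^ (k + 1) + β * z ^ (k + 1)) := by
  have hs : 0 < α + β := by positivity
  have h := (convexOn_pow (𝕜 := ℝ) (k + 1)).2 hx hz (div_nonneg hα hs.le) (div_nonneg hβ.le hs.le)
    (by rw [← add_div, div_self hs.ne'])
  simp only [smul_eq_mul] at h
  have e : α / (α + β) * x + β / (α + β) * z = (α * x + β * z) / (α + β) := by ring
  have e' : α / (α + β) * x ^ (k + 1) + β / (α + β) * z ^ (k + 1)
      = (α * x ^ (k + 1) + β * z ^ (k + 1)) / (α + β) := by ring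
  rw [e, e', div_pow, div_le_div_iff₀ (by positivity) hs, pow_succ (α + β), ← mul_assoc] at h
  have := le_of_mul_le_mul_right h hs
  linarith

theorem add_pow_lt_weighted {α β x z : ℝ} (hα : 0 < α) (hβ : 0 < β) (hx : 0 ≤ x) (hz : 0 ≤ z)
    (hxz : x ≠ z) {k : ℕ} (hk : k ≠ 0) :
    (α * x + β * z) ^ (k + 1) < (α + β) ^ k * (α * x ^ (k + 1) + β * z ^ (k + 1)) := by
  have hs : 0 < α + β := by positivity
  have h := (strictConvexOn_pow (n := k + 1) (by omega)).2 hx hz hxz (div_pos hα hs)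
    (div_pos hβ hs) (by rw [← add_div, div_self hs.ne'])
  simp only [smul_eq_mul] at h
  have e : α / (α + β) * x + β / (α + β) * z = (α * x + β * z) / (α + β) := by ring
  have e' : α / (α + β) * x ^ (k + 1) + β / (α + β) * z ^ (k + 1)
      = (α * x ^ (k + 1) + β * z ^ (k + 1)) / (α + β) := by ring
  rw [e, e', div_pow, div_lt_div_iff₀ (by positivity) hs, pow_succ (α + β), ← mul_assoc] at h
  have := lt_of_mul_lt_mul_right h hs.le
  linarith

theorem binomial_sum_head (M x y : ℝ) (a : ℕ) :
    ∑ j ∈ range (a + 1), (if j = 0 then M else 1) * (x ^ j * y ^ (a - j) * (a.choose j : ℝ))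
      = (M - 1) * y ^ a + (x + y) ^ a := by
  have h : ∀ j, (if j = 0 then M else 1) * (x ^ j * y ^ (a - j) * (a.choose j : ℝ))
      = x ^ j * y ^ (a - j) * (a.choose j : ℝ) + if j = 0 then (M - 1) * y ^ a else 0 := by
    intro j
    split_ifs with h
    · subst h; simp; ring
    · ring
  simp_rw [h]
  rw [sum_add_distrib, ← add_pow, sum_ite_eq' (range (a + 1)) 0]
  simp [add_comm]

/-- Jensen's inequality for `z ↦ z ^ t` with the binomial weights of `(A ^ t + c * B ^ t) ^ a`. -/
theorem binomial_rpow_jensen {A B c M t : ℝ} (hA : 0 < A) (hB : 0 < B) (hc : 0 ≤ c) (hM : 1 ≤ M)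
    (ht : 1 ≤ t) (a : ℕ) :
    ((M - 1) * (A ^ (t - 1)) ^ a + (A ^ (t - 1) + c * B ^ (t - 1)) ^ a) ^ t * (A ^ t + c * B ^ t) ^ a
      ≤ ((1 + c) ^ a + M ^ t - 1) * ((A ^ t + c * B ^ t) ^ a) ^ t := by
  set S : ℝ := A ^ t + c * B ^ t with hS
  have hS0 : 0 < S := by positivity
  have hSa : 0 < S ^ a := by positivity
  set C : ℕ → ℝ := fun j => (c * B ^ t) ^ j * (A ^ t) ^ (a - j) * (a.choose j : ℝ) with hC
  set m : ℕ → ℝ := fun j => if j = 0 then M else 1 with hm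
  set z : ℕ → ℝ := fun j => m j / (B ^ j * A ^ (a - j)) with hz
  have hsum : ∑ j ∈ range (a + 1), C j = S ^ a := by
    rw [hS, add_comm (A ^ t), add_pow]
  have hm0 : ∀ j, 0 < m j := fun j => by
    simp only [hm]; split_ifs <;> linarith
  have hz0 : ∀ j, 0 < z j := fun j => by have := hm0 j; positivity
  have hrp : ∀ {X : ℝ}, 0 < X → X ^ t = X ^ (t - 1) * X := fun {X} hX => by
    rw [← Real.rpow_add_one hX.ne', sub_add_cancel]
  have key := Real.rpow_arith_mean_le_arith_mean_rpow (range (a + 1)) (fun j => C j / S ^ a) z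
    (fun j _ => by positivity) (by rw [← sum_div, hsum, div_self hSa.ne']) (fun j _ => (hz0 j).le) ht
  have e1 : ∑ j ∈ range (a + 1), C j / S ^ a * z j
      = ((M - 1) * (A ^ (t - 1)) ^ a + (A ^ (t - 1) + c * B ^ (t - 1)) ^ a) / S ^ a := by
    rw [add_comm (A ^ (t - 1)), ← binomial_sum_head, sum_div]
    refine sum_congr rfl fun j _ => ?_
    simp only [hC, hz]
    rw [hrp hA, hrp hB, ← mul_assoc c, mul_pow _ B, mul_pow _ A]
    field_simp
    simp only [hm]
  have e2 : ∑ j ∈ range (a + 1), C j / S ^ a * z j ^ t = ((1 + c) ^ a + M ^ t - 1) / S ^ a := by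
    have : (1 + c) ^ a + M ^ t - 1 = (M ^ t - 1) * 1 ^ a + (c + 1) ^ a := by
      rw [one_pow]; ring
    rw [this, ← binomial_sum_head, sum_div]
    refine sum_congr rfl fun j _ => ?_
    have hmt : (if j = 0 then M ^ t else 1) = m j ^ t := by
      simp only [hm]; split_ifs <;> simp
    rw [hmt]
    simp only [hC, hz]
    rw [Real.div_rpow (hm0 j).le (by positivity), Real.mul_rpow (by positivity) (by positivity),
      ← Real.rpow_pow_comm hA.le, ← Real.rpow_pow_comm hB.le, mul_pow c, one_pow]
    field_simp
  rw [e1, e2, Real.div_rpow (by have := sub_nonneg.2 hM; positivity) hSa.le,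
    div_le_div_iff₀ (by positivity) hSa] at key
  exact key

/-- The local inequality for a path of length two, with its case of strictness. -/
theorem local_ineq {M q c t : ℝ} (hM : 1 ≤ M) (hq : 1 ≤ q) (hc : 0 ≤ c) (ht : 1 ≤ t) (k : ℕ) :
    ((M - 1 + q ^ k) ^ t + c * (q ^ k) ^ t) ^ (k + 1) ≤
      ((1 + c) ^ (k + 1) + M ^ t - 1) * ((M - 1 + q ^ (k + 1)) ^ t) ^ k ∧
    (1 < M → 1 < t → k ≠ 0 → q = 1 + c → 0 < c →
      ((M - 1 + q ^ k) ^ t + c * (q ^ k) ^ t) ^ (k + 1) <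
      ((1 + c) ^ (k + 1) + M ^ t - 1) * ((M - 1 + q ^ (k + 1)) ^ t) ^ k) := by
  have hM' := sub_nonneg.2 hM
  have hq0 : 0 < q := by linarith
  set A := M - 1 + q ^ k with hA
  set B := q ^ k with hB
  have hB0 : 0 < B := by positivity
  have hA0 : 0 < A := by positivity
  set S := A ^ t + c * B ^ t with hS
  have hS0 : 0 < S := by positivity
  set W := M - 1 + q ^ (k + 1) with hW
  have hW0 : 0 < W := by positivity
  set Y := (M - 1) * (A ^ (t - 1)) ^ (k + 1) + (A ^ (t - 1) + c * B ^ (t - 1)) ^ (k + 1) with hY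
  have hY0 : 0 < Y := by positivity
  have hrp : ∀ {X : ℝ}, 0 < X → X ^ t = X ^ (t - 1) * X := fun {X} hX => by
    rw [← Real.rpow_add_one hX.ne', sub_add_cancel]
  have eS : S = (M - 1) * A ^ (t - 1) + q ^ (k + 1) * ((A ^ (t - 1) + c * B ^ (t - 1)) / q) := by
    rw [hS, hrp hA0, hrp hB0]
    field_simp
    simp only [hA, hB]
    ring
  have eY : Y = (M - 1) * (A ^ (t - 1)) ^ (k + 1)
      + q ^ (k + 1) * ((A ^ (t - 1) + c * B ^ (t - 1)) / q) ^ (k + 1) := by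
    rw [hY, div_pow, mul_div_cancel₀ _ (by positivity)]
  have h2 : Y ^ t * S ^ (k + 1) ≤ ((1 + c) ^ (k + 1) + M ^ t - 1) * (S ^ (k + 1)) ^ t :=
    binomial_rpow_jensen hA0 hB0 hc hM ht (k + 1)
  have hWY : (W ^ k * Y) ^ t = (W ^ t) ^ k * Y ^ t := by
    rw [Real.mul_rpow (by positivity) hY0.le, Real.rpow_pow_comm hW0.le]
  have hSt : 0 < (S ^ (k + 1)) ^ t := by positivity
  have hWk : 0 < (W ^ t) ^ k := by positivity
  have h3 := mul_le_mul_of_nonneg_left h2 hWk.le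
  refine ⟨?_, fun hM1 ht1 hk hqc hc0 => ?_⟩
  · have h1 : S ^ (k + 1) ≤ W ^ k * Y := by
      rw [eS, eY]
      exact add_pow_le_weighted hM' (by positivity) (by positivity) (by positivity) k
    have h1' := Real.rpow_le_rpow (by positivity) h1 (by linarith : 0 ≤ t)
    rw [hWY] at h1'
    have h1'' := mul_le_mul_of_nonneg_right h1' (by positivity : 0 ≤ S ^ (k + 1))
    refine le_of_mul_le_mul_left ?_ hSt
    linarith
  · have h1 : S ^ (k + 1) < W ^ k * Y := by
      rw [eS, eY]
      refine add_pow_lt_weighted (by linarith) (by positivity) (by positivity) (by positivity) ?_ hk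
      intro h
      rw [eq_div_iff hq0.ne', hqc] at h
      have hlt : B ^ (t - 1) < A ^ (t - 1) :=
        Real.rpow_lt_rpow hB0.le (by simp only [hA]; linarith) (by linarith)
      nlinarith
    have h1' := Real.rpow_lt_rpow (by positivity) h1 (by linarith : 0 < t)
    rw [hWY] at h1'
    have h1'' := mul_lt_mul_of_pos_right h1' (by positivity : 0 < S ^ (k + 1))
    refine lt_of_mul_lt_mul_left ?_ hSt.le
    linarith

/-- A form of Hölder's inequality for two-term sums, with its equality case. -/
theorem prod_add_prod_le {ι : Type*} {s : Finset ι} (hs : s.Nonempty) {X Y T : ι → ℝ} {c : ℝ}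
    (hX : ∀ i ∈ s, 0 ≤ X i) (hY : ∀ i ∈ s, 0 ≤ Y i) (hT : ∀ i ∈ s, 0 < T i) (hc : 0 ≤ c)
    (h : ∀ i ∈ s, X i ^ #s + c * Y i ^ #s ≤ T i ^ #s) :
    ∏ i ∈ s, X i + c * ∏ i ∈ s, Y i ≤ ∏ i ∈ s, T i ∧
      (∏ i ∈ s, X i + c * ∏ i ∈ s, Y i = ∏ i ∈ s, T i →
        (∀ i ∈ s, X i ^ #s + c * Y i ^ #s = T i ^ #s) ∧
        ∀ i ∈ s, ∀ j ∈ s, X i / T i = X j / T j) := by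
  have hn : #s ≠ 0 := hs.card_ne_zero
  have hn0 : (0 : ℝ) < #s := by exact_mod_cast hs.card_pos
  have hw : ∑ _i ∈ s, (1 / #s : ℝ) = 1 := by
    rw [sum_const, nsmul_eq_mul]; field_simp
  have hroot : ∀ {Z : ι → ℝ}, (∀ i ∈ s, 0 ≤ Z i) →
      ∏ i ∈ s, ((Z i / T i) ^ #s) ^ (1 / #s : ℝ) = (∏ i ∈ s, Z i) / ∏ i ∈ s, T i := by
    intro Z hZ
    rw [← prod_div_distrib]
    refine prod_congr rfl fun i hi => ?_
    rw [one_div, Real.pow_rpow_inv_natCast (div_nonneg (hZ i hi) (hT i hi).le) hn]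
  have amgm : ∀ {Z : ι → ℝ}, (∀ i ∈ s, 0 ≤ Z i) →
      (∏ i ∈ s, Z i) / ∏ i ∈ s, T i ≤ ∑ i ∈ s, (1 / #s : ℝ) * (Z i / T i) ^ #s := by
    intro Z hZ
    rw [← hroot hZ]
    exact Real.geom_mean_le_arith_mean_weighted s _ _ (fun i _ => by positivity) hw
      (fun i hi => pow_nonneg (div_nonneg (hZ i hi) (hT i hi).le) _)
  have hTp : 0 < ∏ i ∈ s, T i := prod_pos hT
  have hterm : ∀ i ∈ s, (1 / #s : ℝ) * ((X i / T i) ^ #s + c * (Y i / T i) ^ #s) ≤ 1 / #s := by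
    intro i hi
    have : (X i / T i) ^ #s + c * (Y i / T i) ^ #s ≤ 1 := by
      rw [div_pow, div_pow, mul_div_assoc', ← add_div, div_le_one (pow_pos (hT i hi) _)]
      exact h i hi
    nlinarith [one_div_pos.2 hn0]
  have hsumle := sum_le_sum hterm
  rw [hw] at hsumle
  have hsplit : ∑ i ∈ s, (1 / #s : ℝ) * ((X i / T i) ^ #s + c * (Y i / T i) ^ #s)
      = ∑ i ∈ s, (1 / #s : ℝ) * (X i / T i) ^ #s
        + c * ∑ i ∈ s, (1 / #s : ℝ) * (Y i / T i) ^ #s := by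
    rw [mul_sum, ← sum_add_distrib]
    exact sum_congr rfl fun i _ => by ring
  have aX := amgm hX
  have aY := mul_le_mul_of_nonneg_left (amgm hY) hc
  have hdiv : (∏ i ∈ s, X i + c * ∏ i ∈ s, Y i) / ∏ i ∈ s, T i
      = (∏ i ∈ s, X i) / ∏ i ∈ s, T i + c * ((∏ i ∈ s, Y i) / ∏ i ∈ s, T i) := by ring
  refine ⟨?_, fun heq => ?_⟩
  · rw [← div_le_one hTp, hdiv]
    linarith
  · rw [heq, div_self hTp.ne'] at hdiv
    have htot : ∑ i ∈ s, (1 / #s : ℝ) * ((X i / T i) ^ #s + c * (Y i / T i) ^ #s)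
        = ∑ _i ∈ s, (1 / #s : ℝ) := by
      rw [hw]; linarith
    refine ⟨fun i hi => ?_, ?_⟩
    · have := (sum_eq_sum_iff_of_le hterm).1 htot i hi
      have h1 : (X i / T i) ^ #s + c * (Y i / T i) ^ #s = 1 := by
        field_simp at this ⊢
        linarith
      rwa [div_pow, div_pow, mul_div_assoc', ← add_div, div_eq_one_iff_eq (pow_pos (hT i hi) _).ne']
        at h1
    · have hgeq : ∏ i ∈ s, ((X i / T i) ^ #s) ^ (1 / #s : ℝ)
          = ∑ i ∈ s, (1 / #s : ℝ) * (X i / T i) ^ #s := by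
        rw [hroot hX]; linarith
      have hXT : ∀ i ∈ s, 0 ≤ X i / T i := fun i hi => div_nonneg (hX i hi) (hT i hi).le
      have := (Real.geom_mean_eq_arith_mean_weighted_iff_of_pos s _ _ (fun i _ => by positivity) hw
        (fun i hi => pow_nonneg (hXT i hi) _)).1 hgeq
      intro i hi j hj
      exact (pow_left_inj₀ (hXT i hi) (hXT j hj) hn).1 (this i hi j hj)

/-- `i(K_{a,b})^{1/(ab)}` with fugacity `p` on the `b` vertices of degree `a` and fugacity `q` on
the `a` vertices of degree `b`. -/
noncomputable def edgeFactor (p q : ℝ) (a b : ℕ) : ℝ :=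
  ((1 + p) ^ b + (1 + q) ^ a - 1) ^ (1 / ((a : ℝ) * b))

theorem edgeFactor_comm (p q : ℝ) (a b : ℕ) : edgeFactor p q a b = edgeFactor q p b a := by
  unfold edgeFactor
  rw [add_comm ((1 + p) ^ b), mul_comm (a : ℝ)]

theorem edgeFactor_base_pos {p q : ℝ} (hp : 0 ≤ p) (hq : 0 ≤ q) (a b : ℕ) :
    0 < (1 + p) ^ b + (1 + q) ^ a - 1 := by
  have h1 : 1 ≤ (1 + p) ^ b := one_le_pow₀ (by linarith)
  have h2 : 1 ≤ (1 + q) ^ a := one_le_pow₀ (by linarith)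
  linarith

theorem edgeFactor_pos {p q : ℝ} (hp : 0 ≤ p) (hq : 0 ≤ q) (a b : ℕ) : 0 < edgeFactor p q a b :=
  Real.rpow_pos_of_pos (edgeFactor_base_pos hp hq a b) _

theorem edgeFactor_pow {p q : ℝ} (hp : 0 ≤ p) (hq : 0 ≤ q) (a b m : ℕ) :
    edgeFactor p q a b ^ m = ((1 + p) ^ b + (1 + q) ^ a - 1) ^ ((m : ℝ) / ((a : ℝ) * b)) := by
  unfold edgeFactor
  rw [← Real.rpow_mul_natCast (edgeFactor_base_pos hp hq a b).le]
  congr 1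
  ring

theorem path_ineq {p q c : ℝ} (hp : 0 ≤ p) (hq : 0 ≤ q) (hc : 0 ≤ c) {k b n : ℕ} (hk : k ≠ 0)
    (hb : b ≠ 0) (hbn : b ≤ n) :
    (edgeFactor p q k b ^ n) ^ k + c * (edgeFactor 0 q k b ^ n) ^ k ≤
      (((1 + p) ^ n + (1 + c) ^ (k + 1) - 1) ^ (1 / (((k + 1 : ℕ) : ℝ) * k)) *
        edgeFactor p q (k + 1) b ^ n) ^ k ∧
    (p = 1 → q = 1 → c = 1 → b < n →
      (edgeFactor p q k b ^ n) ^ k + c * (edgeFactor 0 q k b ^ n) ^ k <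
      (((1 + p) ^ n + (1 + c) ^ (k + 1) - 1) ^ (1 / (((k + 1 : ℕ) : ℝ) * k)) *
        edgeFactor p q (k + 1) b ^ n) ^ k) := by
  have hk0 : (k : ℝ) ≠ 0 := by exact_mod_cast hk
  have hb0 : (0 : ℝ) < b := by exact_mod_cast Nat.pos_of_ne_zero hb
  have hk1 : ((k + 1 : ℕ) : ℝ) ≠ 0 := by positivity
  set t : ℝ := (n : ℝ) / b with ht
  have ht1 : 1 ≤ t := (one_le_div hb0).2 (by exact_mod_cast hbn)
  have hp1 : 0 < 1 + p := by linarith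
  have hMt : ((1 + p) ^ b) ^ t = (1 + p) ^ n := by
    rw [← Real.rpow_natCast, ← Real.rpow_mul hp1.le, ht, mul_div_cancel₀ _ hb0.ne',
      Real.rpow_natCast]
  have hX : ∀ {r : ℝ}, 0 ≤ r →
      (edgeFactor r q k b ^ n) ^ k = ((1 + r) ^ b - 1 + (1 + q) ^ k) ^ t := by
    intro r hr
    rw [← pow_mul, edgeFactor_pow hr hq, ht]
    congr 1
    · ring
    · push_cast; field_simp
  have hK := edgeFactor_base_pos hp hc (k + 1) n
  have hT : ((((1 + p) ^ n + (1 + c) ^ (k + 1) - 1) ^ (1 / (((k + 1 : ℕ) : ℝ) * k)) *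
        edgeFactor p q (k + 1) b ^ n) ^ k) ^ (k + 1)
      = ((1 + c) ^ (k + 1) + ((1 + p) ^ b) ^ t - 1) *
        (((1 + p) ^ b - 1 + (1 + q) ^ (k + 1)) ^ t) ^ k := by
    rw [← pow_mul, mul_pow]
    congr 1
    · rw [← Real.rpow_mul_natCast hK.le, hMt]
      have : 1 / (((k + 1 : ℕ) : ℝ) * k) * ((k * (k + 1) : ℕ) : ℝ) = 1 := by
        push_cast at hk1 ⊢; field_simp
      rw [this, Real.rpow_one]
      ring
    · have hB := edgeFactor_base_pos hp hq (k + 1) b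
      rw [← pow_mul, edgeFactor_pow hp hq, ← Real.rpow_mul_natCast
        (by linarith : (0 : ℝ) ≤ (1 + p) ^ b - 1 + (1 + q) ^ (k + 1)), ht]
      congr 1
      · ring
      · push_cast at hk1 ⊢; field_simp
  have hL := local_ineq (M := (1 + p) ^ b) (q := 1 + q) (c := c) (one_le_pow₀ (by linarith))
    (by linarith) hc ht1 k
  have hY := hX le_rfl
  rw [add_zero, one_pow, sub_self, zero_add] at hY
  have hT0 : 0 ≤ (((1 + p) ^ n + (1 + c) ^ (k + 1) - 1) ^ (1 / (((k + 1 : ℕ) : ℝ) * k)) *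
        edgeFactor p q (k + 1) b ^ n) ^ k :=
    pow_nonneg (mul_nonneg (Real.rpow_nonneg hK.le _)
      (pow_nonneg (edgeFactor_pos hp hq _ _).le _)) _
  constructor
  · rw [← pow_le_pow_iff_left₀ (add_nonneg (pow_nonneg (pow_nonneg (edgeFactor_pos hp hq _ _).le _) _)
      (mul_nonneg hc (pow_nonneg (pow_nonneg (edgeFactor_pos le_rfl hq _ _).le _) _))) hT0
      (Nat.succ_ne_zero k), hT, hX hp, hY]
    exact hL.1
  · rintro rfl rfl rfl hlt
    refine lt_of_pow_lt_pow_left₀ (k + 1) hT0 ?_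
    rw [hT, hX hp, hY]
    exact hL.2 (one_lt_pow₀ (by norm_num) hb)
      ((one_lt_div hb0).2 (by exact_mod_cast hlt)) hk rfl one_pos

/-- The contribution to the bound of a vertex of degree `#s` and fugacity `p` whose neighbours form
`s`, the neighbour `v` having fugacity `q v` and degree `b v`. -/
noncomputable def starFactor {ι : Type*} (s : Finset ι) (p : ℝ) (q : ι → ℝ) (b : ι → ℕ) : ℝ :=
  (if #s = 0 then 1 + p else 1) * ∏ v ∈ s, edgeFactor p (q v) #s (b v)

theorem starFactor_pos {ι : Type*} {s : Finset ι} {p : ℝ} {q : ι → ℝ} (hp : 0 ≤ p)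
    (hq : ∀ v, 0 ≤ q v) (b : ι → ℕ) : 0 < starFactor s p q b := by
  refine mul_pos ?_ (prod_pos fun v _ => edgeFactor_pos hp (hq v) _ _)
  split_ifs <;> linarith

theorem edgeFactor_one_pow {p c : ℝ} (hp : 0 ≤ p) (hc : 0 ≤ c) {n : ℕ} (hn : n ≠ 0) :
    edgeFactor p c 1 n ^ n = (1 + p) ^ n + c := by
  have : (n : ℝ) ≠ 0 := by exact_mod_cast hn
  rw [edgeFactor_pow hp hc, Nat.cast_one, one_mul, div_self this, Real.rpow_one]
  ring

theorem star_ineq {ι : Type*} (s : Finset ι) {p c : ℝ} {q : ι → ℝ} {b : ι → ℕ} {n : ℕ}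
    (hp : 0 ≤ p) (hq : ∀ v, 0 ≤ q v) (hc : 0 ≤ c) (hn : n ≠ 0) (hb : ∀ v ∈ s, b v ≠ 0)
    (hbn : ∀ v ∈ s, b v ≤ n) :
    starFactor s p q b ^ n + c * starFactor s 0 q b ^ n ≤
      (edgeFactor p c (#s + 1) n * ∏ v ∈ s, edgeFactor p (q v) (#s + 1) (b v)) ^ n ∧
    (p = 1 → (∀ v ∈ s, q v = 1) → c = 1 →
      starFactor s p q b ^ n + c * starFactor s 0 q b ^ n =
      (edgeFactor p c (#s + 1) n * ∏ v ∈ s, edgeFactor p (q v) (#s + 1) (b v)) ^ n →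
      ∀ v ∈ s, b v = n) := by
  rcases s.eq_empty_or_nonempty with rfl | hs
  · simp [starFactor, edgeFactor_one_pow hp hc hn]
  · have hs0 : #s ≠ 0 := hs.card_ne_zero
    have hs0' : (#s : ℝ) ≠ 0 := by exact_mod_cast hs0
    have hK := edgeFactor_base_pos hp hc (#s + 1) n
    have hx : ∀ r, starFactor s r q b ^ n = ∏ v ∈ s, edgeFactor r (q v) #s (b v) ^ n := by
      intro r
      rw [starFactor, if_neg hs0, one_mul, prod_pow]
    have ht : (edgeFactor p c (#s + 1) n * ∏ v ∈ s, edgeFactor p (q v) (#s + 1) (b v)) ^ n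
        = ∏ v ∈ s, (((1 + p) ^ n + (1 + c) ^ (#s + 1) - 1) ^ (1 / (((#s + 1 : ℕ) : ℝ) * #s)) *
          edgeFactor p (q v) (#s + 1) (b v) ^ n) := by
      rw [prod_mul_distrib, prod_const, mul_pow, prod_pow, edgeFactor_pow hp hc,
        ← Real.rpow_mul_natCast hK.le]
      congr 2
      push_cast
      field_simp
    rw [hx, hx, ht]
    have hold := prod_add_prod_le hs (X := fun v => edgeFactor p (q v) #s (b v) ^ n)
      (Y := fun v => edgeFactor 0 (q v) #s (b v) ^ n)
      (T := fun v => ((1 + p) ^ n + (1 + c) ^ (#s + 1) - 1) ^ (1 / (((#s + 1 : ℕ) : ℝ) * #s)) *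
          edgeFactor p (q v) (#s + 1) (b v) ^ n) (c := c)
      (fun v _ => pow_nonneg (edgeFactor_pos hp (hq v) _ _).le _)
      (fun v _ => pow_nonneg (edgeFactor_pos le_rfl (hq v) _ _).le _)
      (fun v _ => mul_pos (Real.rpow_pos_of_pos hK _) (pow_pos (edgeFactor_pos hp (hq v) _ _) _)) hc
      (fun v hv => (path_ineq hp (hq v) hc hs0 (hb v hv) (hbn v hv)).1)
    refine ⟨hold.1, fun h1 h2 h3 heq v hv => ?_⟩
    by_contra hne
    exact ((path_ineq hp (hq v) hc hs0 (hb v hv) (hbn v hv)).2 h1 (h2 v hv) h3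
      (lt_of_le_of_ne (hbn v hv) hne)).ne ((hold.2 heq).1 v hv)

/-- In a complete bipartite neighbourhood the contributions are explicit. -/
theorem starFactor_pow_of_const {ι : Type*} {s : Finset ι} {p c : ℝ} {q : ι → ℝ} {b : ι → ℕ}
    {n : ℕ} (hp : 0 ≤ p) (hc : 0 ≤ c) (hn : n ≠ 0) (hq : ∀ v ∈ s, q v = c)
    (hb : ∀ v ∈ s, b v = n) :
    starFactor s p q b ^ n = (1 + p) ^ n + (1 + c) ^ #s - 1 := by
  rcases s.eq_empty_or_nonempty with rfl | hs
  · simp [starFactor]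
  · have hs0 : #s ≠ 0 := hs.card_ne_zero
    have hs0' : (#s : ℝ) ≠ 0 := by exact_mod_cast hs0
    have hn0 : (n : ℝ) ≠ 0 := by exact_mod_cast hn
    rw [starFactor, if_neg hs0, one_mul,
      prod_congr rfl (fun v hv => by rw [hq v hv, hb v hv] :
        ∀ v ∈ s, edgeFactor p (q v) #s (b v) = edgeFactor p c #s n), prod_const, ← pow_mul,
      edgeFactor_pow hp hc]
    push_cast
    rw [div_self (by positivity), Real.rpow_one]

theorem star_eq_of_const {ι : Type*} {s : Finset ι} {p c : ℝ} {q : ι → ℝ} {b : ι → ℕ}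
    {n : ℕ} (hp : 0 ≤ p) (hc : 0 ≤ c) (hn : n ≠ 0) (hq : ∀ v ∈ s, q v = c)
    (hb : ∀ v ∈ s, b v = n) :
    (edgeFactor p c (#s + 1) n * ∏ v ∈ s, edgeFactor p (q v) (#s + 1) (b v)) ^ n
      = (1 + p) ^ n + (1 + c) ^ (#s + 1) - 1 := by
  have hn0 : (n : ℝ) ≠ 0 := by exact_mod_cast hn
  have hs0 : ((#s + 1 : ℕ) : ℝ) ≠ 0 := by positivity
  rw [prod_congr rfl (fun v hv => by rw [hq v hv, hb v hv] :
        ∀ v ∈ s, edgeFactor p (q v) (#s + 1) (b v) = edgeFactor p c (#s + 1) n), prod_const,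
      ← pow_succ', ← pow_mul, edgeFactor_pow hp hc]
  rw [Nat.cast_mul, div_self (by positivity), Real.rpow_one]

/-- `G` with all edges at `w` removed. -/
def SimpleGraph.isolate {V : Type*} (G : SimpleGraph V) (w : V) : SimpleGraph V :=
  G.deleteIncidenceSet w

theorem SimpleGraph.isolate_adj {V : Type*} {G : SimpleGraph V} {w u v : V} :
    (G.isolate w).Adj u v ↔ G.Adj u v ∧ u ≠ w ∧ v ≠ w :=
  SimpleGraph.deleteIncidenceSet_adj

/-- The independence polynomial of `G` with vertex fugacities `l`. -/
noncomputable def indepSum {V : Type*} [Fintype V] (G : SimpleGraph V) (l : V → ℝ) : ℝ :=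
  ∑ S : Finset V, if (∀ u ∈ S, ∀ v ∈ S, ¬ G.Adj u v) then ∏ v ∈ S, l v else 0

noncomputable def isolatedFactor {V : Type*} [Fintype V] (G : SimpleGraph V) (l : V → ℝ) (u : V) :
    ℝ :=
  if G.degree u = 0 then 1 + l u else 1

noncomputable def pairFactor {V : Type*} [Fintype V] (G : SimpleGraph V) (l : V → ℝ) (u v : V) :
    ℝ :=
  if G.Adj u v then edgeFactor (l u) (l v) (G.degree u) (G.degree v) else 1

/-- The upper bound for `indepSum G l`; every edge occurs once in each direction, whence the square
roots. -/
noncomputable def indepBound {V : Type*} [Fintype V] (G : SimpleGraph V) (l : V → ℝ) : ℝ :=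
  (∏ u, isolatedFactor G l u) * ∏ u, ∏ v, √(pairFactor G l u v)

section

variable {V : Type*} [Fintype V] {G : SimpleGraph V} {l : V → ℝ}

theorem isolatedFactor_pos (hl : ∀ v, 0 ≤ l v) (u : V) : 0 < isolatedFactor G l u := by
  unfold isolatedFactor
  split_ifs
  · linarith [hl u]
  · exact one_pos

theorem pairFactor_pos (hl : ∀ v, 0 ≤ l v) (u v : V) : 0 < pairFactor G l u v := by
  unfold pairFactor
  split_ifs
  · exact edgeFactor_pos (hl u) (hl v) _ _
  · exact one_pos

theorem pairFactor_comm (u v : V) : pairFactor G l u v = pairFactor G l v u := by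
  unfold pairFactor
  rw [edgeFactor_comm, G.adj_comm]

theorem prod_pairFactor (u : V) : ∏ v, pairFactor G l u v
    = ∏ v ∈ G.neighborFinset u, edgeFactor (l u) (l v) (G.degree u) (G.degree v) := by
  simp only [pairFactor]
  rw [← prod_filter]
  exact prod_congr (by ext; simp) fun _ _ => rfl

/-- The part of `indepBound` away from the vertex set `N`. -/
noncomputable def outerBound (G : SimpleGraph V) (l : V → ℝ) (N : Finset V) : ℝ :=
  (∏ u ∈ Nᶜ, isolatedFactor G l u) * ∏ u ∈ Nᶜ, ∏ v ∈ Nᶜ, √(pairFactor G l u v)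

theorem outerBound_pos (hl : ∀ v, 0 ≤ l v) (N : Finset V) : 0 < outerBound G l N :=
  mul_pos (prod_pos fun u _ => isolatedFactor_pos hl u)
    (prod_pos fun u _ => prod_pos fun v _ => Real.sqrt_pos.2 (pairFactor_pos hl u v))

theorem indepBound_eq_outerBound_mul (hl : ∀ v, 0 ≤ l v) {N : Finset V}
    (hN : ∀ u ∈ N, ∀ v ∈ N, ¬ G.Adj u v) :
    indepBound G l
      = outerBound G l N * ∏ u ∈ N, (isolatedFactor G l u * ∏ v, pairFactor G l u v) := by
  have hcross : ∏ u ∈ Nᶜ, ∏ v ∈ N, √(pairFactor G l u v)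
      = ∏ u ∈ N, ∏ v, √(pairFactor G l u v) := by
    rw [prod_comm]
    refine prod_congr rfl fun u hu => ?_
    rw [← prod_mul_prod_compl N (fun v => √(pairFactor G l u v)),
      prod_eq_one (s := N) fun v hv => by rw [pairFactor, if_neg (hN u hu v hv), Real.sqrt_one],
      one_mul]
    exact prod_congr rfl fun v _ => by rw [pairFactor_comm]
  have hsq : ∏ u ∈ N, ∏ v, pairFactor G l u v
      = (∏ u ∈ N, ∏ v, √(pairFactor G l u v)) * ∏ u ∈ N, ∏ v, √(pairFactor G l u v) := by
    rw [← prod_mul_distrib]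
    refine prod_congr rfl fun u _ => ?_
    rw [← prod_mul_distrib]
    exact prod_congr rfl fun v _ => (Real.mul_self_sqrt (pairFactor_pos hl u v).le).symm
  have hout : ∏ u ∈ Nᶜ, ∏ v, √(pairFactor G l u v)
      = (∏ u ∈ Nᶜ, ∏ v ∈ N, √(pairFactor G l u v))
        * ∏ u ∈ Nᶜ, ∏ v ∈ Nᶜ, √(pairFactor G l u v) := by
    rw [← prod_mul_distrib]
    exact prod_congr rfl fun u _ => (prod_mul_prod_compl N _).symm
  rw [indepBound, ← prod_mul_prod_compl N (fun u => isolatedFactor G l u),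
    ← prod_mul_prod_compl N (fun u => ∏ v, √(pairFactor G l u v)), hout, hcross,
    prod_mul_distrib, hsq, outerBound]
  ring

theorem neighborFinset_isolate {u w : V} (h : u ≠ w) :
    (G.isolate w).neighborFinset u = (G.neighborFinset u).erase w := by
  ext v
  simp only [SimpleGraph.mem_neighborFinset, SimpleGraph.isolate_adj, mem_erase]
  tauto

theorem degree_isolate_of_not_adj {v w : V} (h : v ≠ w) (hvw : ¬ G.Adj v w) :
    (G.isolate w).degree v = G.degree v := by
  rw [← SimpleGraph.card_neighborFinset_eq_degree, neighborFinset_isolate h,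
    erase_eq_of_notMem (by simpa using hvw), SimpleGraph.card_neighborFinset_eq_degree]

theorem degree_isolate_self (w : V) : (G.isolate w).degree w = 0 := by
  rw [← SimpleGraph.card_neighborFinset_eq_degree, card_eq_zero]
  ext v
  simp [SimpleGraph.isolate_adj]

theorem card_neighborFinset_erase {u w : V} (h : G.Adj w u) :
    #((G.neighborFinset u).erase w) + 1 = G.degree u := by
  rw [card_erase_add_one (by simpa using h.symm), SimpleGraph.card_neighborFinset_eq_degree]

theorem indepBound_eq_star (hl : ∀ v, 0 ≤ l v) (htf : ∀ a b c, G.Adj a b → G.Adj b c → ¬ G.Adj a c)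
    (w : V) :
    indepBound G l = outerBound G l (G.neighborFinset w) * ∏ u ∈ G.neighborFinset w,
      (edgeFactor (l u) (l w) (#((G.neighborFinset u).erase w) + 1) (G.degree w) *
        ∏ v ∈ (G.neighborFinset u).erase w,
          edgeFactor (l u) (l v) (#((G.neighborFinset u).erase w) + 1) (G.degree v)) := by
  rw [indepBound_eq_outerBound_mul hl (N := G.neighborFinset w)]
  · congr 1
    refine prod_congr rfl fun u hu => ?_
    rw [SimpleGraph.mem_neighborFinset] at hu
    rw [isolatedFactor, if_neg (by rw [← card_neighborFinset_erase hu]; omega), one_mul,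
      prod_pairFactor, card_neighborFinset_erase hu, mul_prod_erase _
        (fun v => edgeFactor (l u) (l v) (G.degree u) (G.degree v)) (by simpa using hu.symm)]
  · intro u hu v hv huv
    rw [SimpleGraph.mem_neighborFinset] at hu hv
    exact htf _ _ _ hu huv hv

theorem indepBound_isolate_eq_star {m : V → ℝ} (hm : ∀ v, 0 ≤ m v)
    (htf : ∀ a b c, G.Adj a b → G.Adj b c → ¬ G.Adj a c) {w : V} (hdeg : G.degree w ≠ 0)
    (hmw : m w = 0) (hml : ∀ v, v ≠ w → ¬ G.Adj w v → m v = l v) :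
    indepBound (G.isolate w) m
      = outerBound G l (G.neighborFinset w) * ∏ u ∈ G.neighborFinset w,
        starFactor ((G.neighborFinset u).erase w) (m u) l (fun v => G.degree v) := by
  have hadj : ∀ v, ¬ G.Adj w v → v ≠ w → (G.isolate w).degree v = G.degree v :=
    fun v hv hvw => degree_isolate_of_not_adj hvw fun h => hv h.symm
  rw [indepBound_eq_outerBound_mul hm (N := G.neighborFinset w)]
  · congr 1
    · unfold outerBound
      congr 1
      · refine prod_congr rfl fun u hu => ?_
        rw [mem_compl, SimpleGraph.mem_neighborFinset] at hu
        unfold isolatedFactor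
        by_cases huw : u = w
        · subst huw
          rw [if_pos (degree_isolate_self u), if_neg hdeg, hmw, add_zero]
        · rw [hadj u hu huw, hml u huw hu]
      · refine prod_congr rfl fun u hu => prod_congr rfl fun v hv => ?_
        rw [mem_compl, SimpleGraph.mem_neighborFinset] at hu hv
        congr 1
        unfold pairFactor
        by_cases huv : G.Adj u v
        · have huw : u ≠ w := by rintro rfl; exact hv huv
          have hvw : v ≠ w := by rintro rfl; exact hu huv.symm
          rw [if_pos huv, if_pos (SimpleGraph.isolate_adj.2 ⟨huv, huw, hvw⟩),
            hadj u hu huw, hadj v hv hvw, hml u huw hu, hml v hvw hv]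
        · rw [if_neg huv, if_neg fun h => huv (SimpleGraph.isolate_adj.1 h).1]
    · refine prod_congr rfl fun u hu => ?_
      rw [SimpleGraph.mem_neighborFinset] at hu
      have hd : (G.isolate w).degree u = #((G.neighborFinset u).erase w) := by
        rw [← SimpleGraph.card_neighborFinset_eq_degree, neighborFinset_isolate hu.ne']
      rw [starFactor, isolatedFactor, prod_pairFactor, hd, neighborFinset_isolate hu.ne']
      congr 1
      refine prod_congr rfl fun v hv => ?_
      rw [mem_erase, SimpleGraph.mem_neighborFinset] at hv
      have hwv : ¬ G.Adj w v := htf _ _ _ hu hv.2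
      rw [hml v hv.1 hwv, hadj v hwv hv.1]
  · intro u hu v hv huv
    rw [SimpleGraph.mem_neighborFinset] at hu hv
    exact htf _ _ _ hu (SimpleGraph.isolate_adj.1 huv).1 hv

theorem indepSum_recursion (w : V) :
    indepSum G l = indepSum (G.isolate w) (fun v => if v = w then 0 else l v) +
      l w * indepSum (G.isolate w) (fun v => if v = w ∨ G.Adj w v then 0 else l v) := by
  have hw : w ∉ univ.erase w := notMem_erase w univ
  have huniv : (univ : Finset (Finset V)) = (insert w (univ.erase w)).powerset := by
    rw [insert_erase (mem_univ w), powerset_univ]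
  unfold indepSum
  rw [huniv, sum_powerset_insert hw, sum_powerset_insert hw, sum_powerset_insert hw]
  have hz : ∀ m : V → ℝ, m w = 0 → ∑ t ∈ (univ.erase w).powerset,
      (if (∀ u ∈ insert w t, ∀ v ∈ insert w t, ¬ (G.isolate w).Adj u v)
        then ∏ v ∈ insert w t, m v else 0) = 0 := by
    intro m hm
    refine sum_eq_zero fun t _ => ?_
    rw [prod_eq_zero (mem_insert_self w t) hm, ite_self]
  rw [hz _ (if_pos rfl), hz _ (if_pos (Or.inl rfl)), add_zero, add_zero, mul_sum]
  have hiff : ∀ t ∈ (univ.erase w).powerset,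
      ((∀ u ∈ t, ∀ v ∈ t, ¬ (G.isolate w).Adj u v) ↔ ∀ u ∈ t, ∀ v ∈ t, ¬ G.Adj u v) := by
    intro t ht
    have hwt : ∀ u ∈ t, u ≠ w := fun u hu => ne_of_mem_erase (mem_powerset.1 ht hu)
    simp only [SimpleGraph.isolate_adj]
    exact ⟨fun h u hu v hv huv => h u hu v hv ⟨huv, hwt u hu, hwt v hv⟩,
      fun h u hu v hv huv => h u hu v hv huv.1⟩
  congr 1
  · refine sum_congr rfl fun t ht => ?_
    rw [if_congr (hiff t ht) rfl rfl]
    congr 1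
    exact prod_congr rfl fun v hv => (if_neg (ne_of_mem_erase (mem_powerset.1 ht hv))).symm
  · refine sum_congr rfl fun t ht => ?_
    have hwt : w ∉ t := fun h => hw (mem_powerset.1 ht h)
    rw [if_congr (hiff t ht) rfl rfl, prod_insert hwt]
    by_cases hN : ∃ v ∈ t, G.Adj w v
    · obtain ⟨v, hv, hwv⟩ := hN
      rw [prod_eq_zero (f := fun v => if v = w ∨ G.Adj w v then 0 else l v) hv
        (if_pos (Or.inr hwv)), ite_self, mul_zero, if_neg]
      exact fun h => h w (mem_insert_self w t) v (mem_insert_of_mem hv) hwv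
    · push Not at hN
      have hi : (∀ u ∈ insert w t, ∀ v ∈ insert w t, ¬ G.Adj u v) ↔ ∀ u ∈ t, ∀ v ∈ t, ¬ G.Adj u v := by
        simp only [forall_mem_insert, SimpleGraph.irrefl, not_false_eq_true, true_and]
        exact ⟨fun h u hu => (h.2 u hu).2, fun h => ⟨hN, fun u hu => ⟨fun h' => hN u hu h'.symm, h u hu⟩⟩⟩
      rw [if_congr hi rfl rfl, mul_ite, mul_zero]
      congr 2
      refine prod_congr rfl fun v hv => (if_neg ?_).symm
      rintro (rfl | h)
      · exact hwt hv
      · exact hN v hv h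

theorem indepSum_eq_indepBound_of_degree_eq_zero (h : ∀ v, G.degree v = 0) :
    indepSum G l = indepBound G l := by
  have hadj : ∀ u v, ¬ G.Adj u v := fun u v huv => by
    have := (G.degree_pos_iff_exists_adj u).2 ⟨v, huv⟩
    rw [h u] at this
    omega
  simp only [indepSum, indepBound, isolatedFactor, pairFactor, h, hadj, not_false_eq_true,
    implies_true, if_true, if_false, Real.sqrt_one, prod_const_one, mul_one]
  rw [prod_one_add, powerset_univ]

end

theorem isolate_lt {V : Type*} {G : SimpleGraph V} {u w : V} (h : G.Adj w u) : G.isolate w < G := by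
  refine lt_of_le_of_ne (fun a b hab => (SimpleGraph.isolate_adj.1 hab).1) fun heq => ?_
  rw [← heq] at h
  exact (SimpleGraph.isolate_adj.1 h).2.1 rfl

theorem isolate_triangle_free {V : Type*} {G : SimpleGraph V}
    (htf : ∀ a b c, G.Adj a b → G.Adj b c → ¬ G.Adj a c) (w : V) :
    ∀ a b c, (G.isolate w).Adj a b → (G.isolate w).Adj b c → ¬ (G.isolate w).Adj a c := by
  simp only [SimpleGraph.isolate_adj]
  exact fun a b c h h' h'' => htf a b c h.1 h'.1 h''.1

section

variable {V : Type*} [Fintype V] {G : SimpleGraph V} {l : V → ℝ}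

theorem indepBound_isolate_eq (hl : ∀ v, 0 ≤ l v)
    (htf : ∀ a b c, G.Adj a b → G.Adj b c → ¬ G.Adj a c) {w : V} (hdeg : G.degree w ≠ 0) :
    indepBound (G.isolate w) (fun v => if v = w then 0 else l v)
      = outerBound G l (G.neighborFinset w) * ∏ u ∈ G.neighborFinset w,
        starFactor ((G.neighborFinset u).erase w) (l u) l (fun v => G.degree v) := by
  rw [indepBound_isolate_eq_star (l := l) (fun v => by split_ifs <;> simp [hl]) htf hdeg
    (if_pos rfl) fun v hv _ => if_neg hv]
  congr 1
  refine prod_congr rfl fun u hu => ?_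
  rw [SimpleGraph.mem_neighborFinset] at hu
  rw [if_neg hu.ne']

theorem indepBound_isolate_neighbors_eq (hl : ∀ v, 0 ≤ l v)
    (htf : ∀ a b c, G.Adj a b → G.Adj b c → ¬ G.Adj a c) {w : V} (hdeg : G.degree w ≠ 0) :
    indepBound (G.isolate w) (fun v => if v = w ∨ G.Adj w v then 0 else l v)
      = outerBound G l (G.neighborFinset w) * ∏ u ∈ G.neighborFinset w,
        starFactor ((G.neighborFinset u).erase w) 0 l (fun v => G.degree v) := by
  rw [indepBound_isolate_eq_star (l := l) (m := fun v => if v = w ∨ G.Adj w v then 0 else l v)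
    (fun v => by split_ifs <;> simp [hl]) htf hdeg (if_pos (Or.inl rfl))
    fun v hv h => if_neg (by tauto)]
  congr 1
  refine prod_congr rfl fun u hu => ?_
  rw [SimpleGraph.mem_neighborFinset] at hu
  rw [if_pos (Or.inr hu)]

theorem indepBound_isolate_add_le (hl : ∀ v, 0 ≤ l v)
    (htf : ∀ a b c, G.Adj a b → G.Adj b c → ¬ G.Adj a c) {w : V} (hdeg : G.degree w ≠ 0)
    (hmax : ∀ v, G.degree v ≤ G.degree w) :
    indepBound (G.isolate w) (fun v => if v = w then 0 else l v) +
      l w * indepBound (G.isolate w) (fun v => if v = w ∨ G.Adj w v then 0 else l v)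
        ≤ indepBound G l ∧
    ((∀ v, G.degree v ≠ 0 → l v = 1) →
      indepBound (G.isolate w) (fun v => if v = w then 0 else l v) +
        l w * indepBound (G.isolate w) (fun v => if v = w ∨ G.Adj w v then 0 else l v)
          = indepBound G l →
      (∀ u v, G.Adj w u → G.Adj u v → G.degree v = G.degree w) ∧
        ∀ u u', G.Adj w u → G.Adj w u' → G.degree u = G.degree u') := by
  rw [indepBound_isolate_eq hl htf hdeg, indepBound_isolate_neighbors_eq hl htf hdeg,
    indepBound_eq_star hl htf w]
  set N := G.neighborFinset w with hN
  set n := G.degree w with hn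
  have hcard : #N = n := SimpleGraph.card_neighborFinset_eq_degree G w
  have hNne : N.Nonempty := by rw [← card_pos, hcard]; omega
  have hR : 0 < outerBound G l N := outerBound_pos hl N
  have hd0 : ∀ {u v}, G.Adj u v → G.degree v ≠ 0 := fun {u v} h =>
    ((G.degree_pos_iff_exists_adj v).2 ⟨u, h.symm⟩).ne'
  have hadj : ∀ u, ∀ v ∈ (G.neighborFinset u).erase w, G.Adj u v := fun u v hv => by
    simpa using mem_of_mem_erase hv
  have hstar := fun u => star_ineq ((G.neighborFinset u).erase w) (b := fun v => G.degree v)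
    (hl u) hl (hl w) hdeg (fun v hv => hd0 (hadj u v hv)) (fun v _ => hmax v)
  have hold := prod_add_prod_le hNne
    (X := fun u => starFactor ((G.neighborFinset u).erase w) (l u) l (fun v => G.degree v))
    (Y := fun u => starFactor ((G.neighborFinset u).erase w) 0 l (fun v => G.degree v))
    (T := fun u => edgeFactor (l u) (l w) (#((G.neighborFinset u).erase w) + 1) n *
        ∏ v ∈ (G.neighborFinset u).erase w,
          edgeFactor (l u) (l v) (#((G.neighborFinset u).erase w) + 1) (G.degree v)) (c := l w)
    (fun u _ => (starFactor_pos (hl u) hl _).le) (fun u _ => (starFactor_pos le_rfl hl _).le)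
    (fun u _ => mul_pos (edgeFactor_pos (hl u) (hl w) _ _)
      (prod_pos fun v _ => edgeFactor_pos (hl u) (hl v) _ _)) (hl w)
    (fun u _ => by rw [hcard]; exact (hstar u).1)
  rw [hcard] at hold
  constructor
  · refine le_trans (le_of_eq ?_) (mul_le_mul_of_nonneg_left hold.1 hR.le)
    ring
  · intro h1 heq
    have heq' := hold.2 (mul_left_cancel₀ hR.ne' (by rw [← heq]; ring))
    have hw1 : l w = 1 := h1 w hdeg
    have hu1 : ∀ u ∈ N, l u = 1 := fun u hu => h1 u (hd0 (by simpa [hN] using hu : G.Adj w u))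
    have hdist : ∀ u ∈ N, ∀ v ∈ (G.neighborFinset u).erase w, G.degree v = n := fun u hu =>
      (hstar u).2 (hu1 u hu) (fun v hv => h1 v (hd0 (hadj u v hv))) hw1 (heq'.1 u hu)
    refine ⟨fun u v hwu huv => ?_, fun u u' hwu hwu' => ?_⟩
    · by_cases hvw : v = w
      · rw [hvw]
      · exact hdist u (by simpa [hN] using hwu) v (by simp [hvw, huv])
    · have huN : u ∈ N := by simpa [hN] using hwu
      have huN' : u' ∈ N := by simpa [hN] using hwu'
      have hX : ∀ x ∈ N, starFactor ((G.neighborFinset x).erase w) (l x) l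
          (fun v => G.degree v) ^ n = 2 ^ n + 2 ^ #((G.neighborFinset x).erase w) - 1 := by
        intro x hx
        rw [starFactor_pow_of_const (c := 1) (hl x) zero_le_one hdeg
          (fun v hv => h1 v (hd0 (hadj x v hv))) (hdist x hx), hu1 x hx]
        norm_num
      have hT : ∀ x ∈ N, (edgeFactor (l x) (l w) (#((G.neighborFinset x).erase w) + 1) n *
          ∏ v ∈ (G.neighborFinset x).erase w, edgeFactor (l x) (l v)
            (#((G.neighborFinset x).erase w) + 1) (G.degree v)) ^ n
          = 2 ^ n + 2 * 2 ^ #((G.neighborFinset x).erase w) - 1 := by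
        intro x hx
        rw [star_eq_of_const (hl x) (hl w) hdeg
          (fun v hv => (h1 v (hd0 (hadj x v hv))).trans hw1.symm) (hdist x hx), hu1 x hx, hw1,
          pow_succ]
        norm_num
        ring
      have hr := congrArg (· ^ n) (heq'.2 u huN u' huN')
      simp only [div_pow] at hr
      rw [hX u huN, hX u' huN', hT u huN, hT u' huN'] at hr
      have hD : (1 : ℝ) < 2 ^ n := one_lt_pow₀ (by norm_num) hdeg
      have hx : (0 : ℝ) < 2 ^ #((G.neighborFinset u).erase w) := by positivity
      have hx' : (0 : ℝ) < 2 ^ #((G.neighborFinset u').erase w) := by positivity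
      rw [div_eq_div_iff (by linarith) (by linarith)] at hr
      have hxx : (2 : ℝ) ^ #((G.neighborFinset u).erase w)
          = 2 ^ #((G.neighborFinset u').erase w) := by
        refine mul_left_cancel₀ (sub_pos.2 hD).ne' ?_
        linarith
      have hc := pow_right_injective₀ (by norm_num : (0 : ℝ) < 2) (by norm_num) hxx
      rw [← card_neighborFinset_erase hwu, ← card_neighborFinset_erase hwu', hc]

theorem exists_max_degree_ne_zero (h : ¬ ∀ v, G.degree v = 0) :
    ∃ w, G.degree w ≠ 0 ∧ ∀ v, G.degree v ≤ G.degree w := by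
  push Not at h
  obtain ⟨v, hv⟩ := h
  obtain ⟨w, -, hw⟩ := exists_max_image univ (fun v => G.degree v) ⟨v, mem_univ v⟩
  refine ⟨w, ?_, fun v => hw v (mem_univ v)⟩
  have := hw v (mem_univ v)
  omega

/-- The weighted upper bound for triangle-free graphs. -/
theorem indepSum_le_indepBound (G : SimpleGraph V) (l : V → ℝ) (hl : ∀ v, 0 ≤ l v)
    (htf : ∀ a b c, G.Adj a b → G.Adj b c → ¬ G.Adj a c) : indepSum G l ≤ indepBound G l := by
  induction G using WellFoundedLT.induction generalizing l with
  | ind G ih =>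
    by_cases h : ∀ v, G.degree v = 0
    · exact (indepSum_eq_indepBound_of_degree_eq_zero h).le
    · obtain ⟨w, hw, hmax⟩ := exists_max_degree_ne_zero h
      obtain ⟨u, hu⟩ := (G.degree_pos_iff_exists_adj w).1 (Nat.pos_of_ne_zero hw)
      rw [indepSum_recursion w]
      refine le_trans (add_le_add
        (ih _ (isolate_lt hu) _ (fun v => ?_) (isolate_triangle_free htf w))
        (mul_le_mul_of_nonneg_left (ih _ (isolate_lt hu) _ (fun v => ?_)
          (isolate_triangle_free htf w)) (hl w)))
        (indepBound_isolate_add_le hl htf hw hmax).1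
      · split_ifs <;> simp [hl]
      · split_ifs <;> simp [hl]

/-- In the case of equality every path on four vertices closes up to a four-cycle. -/
theorem adj_of_path_of_indepSum_eq (G : SimpleGraph V) (l : V → ℝ) (hl : ∀ v, 0 ≤ l v)
    (hl1 : ∀ v, G.degree v ≠ 0 → l v = 1)
    (htf : ∀ a b c, G.Adj a b → G.Adj b c → ¬ G.Adj a c) (heq : indepSum G l = indepBound G l) :
    ∀ a b c d, G.Adj a b → G.Adj b c → G.Adj c d → G.Adj a d := by
  induction G using WellFoundedLT.induction generalizing l with
  | ind G ih =>
    have hd0 : ∀ {u v}, G.Adj u v → G.degree u ≠ 0 := fun {u v} h =>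
      ((G.degree_pos_iff_exists_adj u).2 ⟨v, h⟩).ne'
    by_cases h : ∀ v, G.degree v = 0
    · exact fun a b c d hab => absurd (h a) (hd0 hab)
    obtain ⟨w, hw, hmax⟩ := exists_max_degree_ne_zero h
    obtain ⟨x, hx⟩ := (G.degree_pos_iff_exists_adj w).1 (Nat.pos_of_ne_zero hw)
    have hl0 : ∀ v, 0 ≤ (fun v => if v = w then 0 else l v) v := fun v => by
      dsimp only; split_ifs <;> simp [hl]
    have hlN : ∀ v, 0 ≤ (fun v => if v = w ∨ G.Adj w v then 0 else l v) v := fun v => by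
      dsimp only; split_ifs <;> simp [hl]
    have h0 := indepSum_le_indepBound _ _ hl0 (isolate_triangle_free htf w)
    have hN : ∀ z, G.degree z ≠ 0 → l z * indepSum (G.isolate z)
        (fun v => if v = z ∨ G.Adj z v then 0 else l v) ≤ l z * indepBound (G.isolate z)
        (fun v => if v = z ∨ G.Adj z v then 0 else l v) := fun z _ =>
      mul_le_mul_of_nonneg_left (indepSum_le_indepBound _ _
        (fun v => by split_ifs <;> simp [hl]) (isolate_triangle_free htf z)) (hl z)
    have hlocal : ∀ z, G.degree z ≠ 0 → (∀ v, G.degree v ≤ G.degree z) →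
        (∀ u v, G.Adj z u → G.Adj u v → G.degree v = G.degree z) ∧
          ∀ u u', G.Adj z u → G.Adj z u' → G.degree u = G.degree u' := by
      intro z hz hzmax
      have hstep := indepBound_isolate_add_le hl htf hz hzmax
      refine hstep.2 hl1 (le_antisymm hstep.1 ?_)
      rw [← heq, indepSum_recursion z]
      exact add_le_add (indepSum_le_indepBound _ _
        (fun v => by split_ifs <;> simp [hl]) (isolate_triangle_free htf z)) (hN z hz)
    have heq0 : indepSum (G.isolate w) (fun v => if v = w then 0 else l v)
        = indepBound (G.isolate w) (fun v => if v = w then 0 else l v) := by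
      have h1 := (indepBound_isolate_add_le hl htf hw hmax).1
      rw [← heq, indepSum_recursion w] at h1
      have := hN w hw
      linarith
    have hclosed := ih _ (isolate_lt hx) _ hl0 (fun v hv => by
      obtain ⟨u, hu⟩ := ((G.isolate w).degree_pos_iff_exists_adj v).1 (Nat.pos_of_ne_zero hv)
      have hu' := SimpleGraph.isolate_adj.1 hu
      rw [if_neg hu'.2.1]
      exact hl1 v (hd0 hu'.1)) (isolate_triangle_free htf w) heq0
    have hclosed' : ∀ a b c d, a ≠ w → b ≠ w → c ≠ w → d ≠ w →
        G.Adj a b → G.Adj b c → G.Adj c d → G.Adj a d := by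
      intro a b c d ha hb hc hd hab hbc hcd
      simp only [SimpleGraph.isolate_adj] at hclosed
      exact (hclosed a b c d ⟨hab, ha, hb⟩ ⟨hbc, hb, hc⟩ ⟨hcd, hc, hd⟩).1
    obtain ⟨hdist, hnbr⟩ := hlocal w hw hmax
    have hfrom : ∀ u v u', G.Adj w u → G.Adj u v → G.Adj v u' → G.Adj w u' := by
      intro u v u' hwu huv hvu'
      by_contra hwu'
      have hvw : v ≠ w := by rintro rfl; exact hwu' hvu'
      have hu'w : u' ≠ w := by rintro rfl; exact htf _ _ _ hwu huv hvu'.symm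
      have hv : G.degree v = G.degree w := hdist u v hwu huv
      have hvloc := hlocal v (by omega) (fun z => by rw [hv]; exact hmax z)
      have huu' : G.degree u = G.degree u' := hvloc.2 u u' huv.symm hvu'
      have hsub : G.neighborFinset u' ⊆ (G.neighborFinset u).erase w := by
        intro y hy
        rw [SimpleGraph.mem_neighborFinset] at hy
        have hyw : y ≠ w := by rintro rfl; exact hwu' hy.symm
        rw [mem_erase, SimpleGraph.mem_neighborFinset]
        exact ⟨hyw, hclosed' u v u' y hwu.ne' hvw hu'w hyw huv hvu' hy⟩
      have hle := card_le_card hsub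
      have := card_neighborFinset_erase hwu
      rw [SimpleGraph.card_neighborFinset_eq_degree] at hle
      omega
    have htwin : ∀ r s, G.Adj w r → G.Adj r s → ∀ y, G.Adj w y → G.Adj s y := by
      intro r s hwr hrs y hwy
      have hsub : G.neighborFinset s ⊆ G.neighborFinset w := by
        intro z hz
        rw [SimpleGraph.mem_neighborFinset] at hz ⊢
        exact hfrom r s z hwr hrs hz
      have := eq_of_subset_of_card_le hsub (by
        rw [SimpleGraph.card_neighborFinset_eq_degree, SimpleGraph.card_neighborFinset_eq_degree,
          hdist r s hwr hrs])
      rw [← SimpleGraph.mem_neighborFinset, this, SimpleGraph.mem_neighborFinset]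
      exact hwy
    intro a b c d hab hbc hcd
    by_cases ha : a = w
    · subst ha; exact hfrom b c d hab hbc hcd
    by_cases hd : d = w
    · subst hd; exact (hfrom c b a hcd.symm hbc.symm hab.symm).symm
    by_cases hb : b = w
    · subst hb; exact (htwin c d hbc hcd a hab.symm).symm
    by_cases hc : c = w
    · subst hc; exact htwin b a hbc.symm hab.symm d hcd
    exact hclosed' a b c d ha hb hc hd hab hbc hcd

/-- Equality holds when every path on four vertices closes up to a four-cycle. -/
theorem indepSum_eq_indepBound_of_closed (G : SimpleGraph V) (l : V → ℝ) (hl : ∀ v, 0 ≤ l v)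
    (hcl : ∀ a b c d, G.Adj a b → G.Adj b c → G.Adj c d → G.Adj a d)
    (hconst : ∀ u v u', G.Adj u v → G.Adj v u' → l u = l u') : indepSum G l = indepBound G l := by
  induction G using WellFoundedLT.induction generalizing l with
  | ind G ih =>
    have htf : ∀ a b c, G.Adj a b → G.Adj b c → ¬ G.Adj a c := fun a b c hab hbc hac =>
      G.irrefl (hcl a b c a hab hbc hac.symm)
    by_cases h : ∀ v, G.degree v = 0
    · exact indepSum_eq_indepBound_of_degree_eq_zero h
    obtain ⟨w, hw, -⟩ := exists_max_degree_ne_zero h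
    obtain ⟨x, hx⟩ := (G.degree_pos_iff_exists_adj w).1 (Nat.pos_of_ne_zero hw)
    have hcl' : ∀ a b c d, (G.isolate w).Adj a b → (G.isolate w).Adj b c → (G.isolate w).Adj c d →
        (G.isolate w).Adj a d := by
      simp only [SimpleGraph.isolate_adj]
      exact fun a b c d h1 h2 h3 => ⟨hcl a b c d h1.1 h2.1 h3.1, h1.2.1, h3.2.2⟩
    rw [indepSum_recursion w, ih _ (isolate_lt hx) _ (fun v => by split_ifs <;> simp [hl]) hcl',
      ih _ (isolate_lt hx) _ (fun v => by split_ifs <;> simp [hl]) hcl',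
      indepBound_isolate_eq hl htf hw, indepBound_isolate_neighbors_eq hl htf hw,
      indepBound_eq_star hl htf w]
    · have hnb : ∀ u ∈ G.neighborFinset w, G.neighborFinset u = G.neighborFinset x := by
        intro u hu
        rw [SimpleGraph.mem_neighborFinset] at hu
        ext y
        rw [SimpleGraph.mem_neighborFinset, SimpleGraph.mem_neighborFinset]
        exact ⟨fun hy => (hcl y u w x hy.symm hu.symm hx).symm,
          fun hy => (hcl y x w u hy.symm hx.symm hu).symm⟩
      have hlu : ∀ u ∈ G.neighborFinset w, l u = l x := fun u hu =>
        hconst u w x (by simpa [G.adj_comm] using hu) hx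
      have hlv : ∀ v ∈ (G.neighborFinset x).erase w, l v = l w := fun v hv =>
        hconst v x w (by simpa [G.adj_comm] using mem_of_mem_erase hv) hx.symm
      have hdv : ∀ v ∈ (G.neighborFinset x).erase w, G.degree v = G.degree w := by
        intro v hv
        have hxv : G.Adj x v := by simpa using mem_of_mem_erase hv
        rw [← SimpleGraph.card_neighborFinset_eq_degree, ← SimpleGraph.card_neighborFinset_eq_degree]
        congr 1
        ext y
        rw [SimpleGraph.mem_neighborFinset, SimpleGraph.mem_neighborFinset]
        exact ⟨fun hy => (hcl y v x w hy.symm hxv.symm hx.symm).symm,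
          fun hy => (hcl y w x v hy.symm hx hxv).symm⟩
      rw [prod_eq_pow_card (b := starFactor ((G.neighborFinset x).erase w) (l x) l
          fun v => G.degree v) fun u hu => by rw [hnb u hu, hlu u hu],
        prod_eq_pow_card (b := starFactor ((G.neighborFinset x).erase w) 0 l
          fun v => G.degree v) fun u hu => by rw [hnb u hu],
        prod_eq_pow_card (b := edgeFactor (l x) (l w) (#((G.neighborFinset x).erase w) + 1)
            (G.degree w) * ∏ v ∈ (G.neighborFinset x).erase w,
              edgeFactor (l x) (l v) (#((G.neighborFinset x).erase w) + 1) (G.degree v))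
          fun u hu => by rw [hnb u hu, hlu u hu],
        SimpleGraph.card_neighborFinset_eq_degree,
        starFactor_pow_of_const (hl x) (hl w) hw hlv hdv,
        starFactor_pow_of_const le_rfl (hl w) hw hlv hdv,
        star_eq_of_const (hl x) (hl w) hw hlv hdv]
      rw [pow_succ]
      simp only [add_zero, one_pow]
      ring
    · intro u v u' huv hvu'
      rw [SimpleGraph.isolate_adj] at huv hvu'
      have hiff : G.Adj w u ↔ G.Adj w u' :=
        ⟨fun h => hcl w u v u' h huv.1 hvu'.1, fun h => hcl w u' v u h hvu'.1.symm huv.1.symm⟩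
      simp only [huv.2.1, hvu'.2.2, hiff, false_or, hconst u v u' huv.1 hvu'.1]
    · intro u v u' huv hvu'
      rw [SimpleGraph.isolate_adj] at huv hvu'
      simp only [huv.2.1, hvu'.2.2, if_false, hconst u v u' huv.1 hvu'.1]

end

/-- The bipartite double cover of `G`. -/
def SimpleGraph.doubleCover {V : Type*} (G : SimpleGraph V) : SimpleGraph (V × Bool) where
  Adj x y := G.Adj x.1 y.1 ∧ x.2 ≠ y.2
  symm := ⟨fun _ _ h => ⟨h.1.symm, h.2.symm⟩⟩
  loopless := ⟨fun _ h => h.2 rfl⟩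

theorem SimpleGraph.doubleCover_adj {V : Type*} {G : SimpleGraph V} {x y : V × Bool} :
    G.doubleCover.Adj x y ↔ G.Adj x.1 y.1 ∧ x.2 ≠ y.2 :=
  Iff.rfl

theorem doubleCover_triangle_free {V : Type*} {G : SimpleGraph V} (a b c : V × Bool)
    (hab : G.doubleCover.Adj a b) (hbc : G.doubleCover.Adj b c) : ¬ G.doubleCover.Adj a c := by
  rw [SimpleGraph.doubleCover_adj] at *
  intro hac
  have h1 := hab.2
  have h2 := hbc.2
  have h3 := hac.2
  cases ha : a.2 <;> cases hb : b.2 <;> cases hc : c.2 <;> simp_all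

section

variable {V : Type*} [Fintype V] {G : SimpleGraph V}

theorem indepSum_one : indepSum G (fun _ => 1) = numIndepSets G := by
  simp [indepSum, numIndepSets]

theorem degree_doubleCover (x : V × Bool) : G.doubleCover.degree x = G.degree x.1 := by
  have : G.doubleCover.neighborFinset x = G.neighborFinset x.1 ×ˢ {!x.2} := by
    ext y
    simp only [SimpleGraph.mem_neighborFinset, SimpleGraph.doubleCover_adj, mem_product,
      mem_singleton]
    cases x.2 <;> cases y.2 <;> simp
  rw [← SimpleGraph.card_neighborFinset_eq_degree, this, card_product, card_singleton, mul_one,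
    SimpleGraph.card_neighborFinset_eq_degree]

theorem indepBound_doubleCover :
    indepBound G.doubleCover (fun _ => 1) = indepBound G (fun _ => 1) ^ 2 := by
  have hiso : ∀ x, isolatedFactor G.doubleCover (fun _ => 1) x
      = isolatedFactor G (fun _ => 1) x.1 := fun x => by
    rw [isolatedFactor, isolatedFactor, degree_doubleCover]
  have hpair : ∀ x y, pairFactor G.doubleCover (fun _ => 1) x y
      = if x.2 ≠ y.2 then pairFactor G (fun _ => 1) x.1 y.1 else 1 := fun x y => by
    simp only [pairFactor, degree_doubleCover, SimpleGraph.doubleCover_adj, and_comm, ite_and]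
  simp only [indepBound, hiso, hpair, Fintype.prod_prod_type, Fintype.prod_bool]
  simp [prod_mul_distrib]
  ring

/-- Swapping along symmetric differences injects pairs of independent sets of `G` into independent
sets of its double cover. -/
theorem numIndepSets_sq_le : numIndepSets G ^ 2 ≤ numIndepSets G.doubleCover := by
  let indep : Finset V → Prop := fun S => ∀ u ∈ S, ∀ v ∈ S, ¬ G.Adj u v
  have hex : ∀ U I : Finset V, ∃ W : Finset V, ∀ S T, indep S → indep T → S ∪ T = U → S ∩ T = I →
      indep W ∧ ∀ u ∈ U, u ∉ W → ∀ v ∈ U, v ∉ W → ¬ G.Adj u v := by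
    intro U I
    by_cases h : ∃ S T, indep S ∧ indep T ∧ S ∪ T = U ∧ S ∩ T = I
    · obtain ⟨S, T, hS, hT, rfl, -⟩ := h
      refine ⟨S, fun _ _ _ _ _ _ => ⟨hS, fun u hu huS v hv hvS => hT u ?_ v ?_⟩⟩
      · exact (mem_union.1 hu).resolve_left huS
      · exact (mem_union.1 hv).resolve_left hvS
    · exact ⟨∅, fun S T hS hT hU hI => absurd ⟨S, T, hS, hT, hU, hI⟩ h⟩
  choose W hW using hex
  let φ : Finset V × Finset V → Finset (V × Bool) := fun p => univ.filter fun x =>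
    (x.1 ∈ p.1 ∧ x.1 ∈ p.2) ∨ (x.1 ∈ p.1 ∨ x.1 ∈ p.2) ∧
      ((x.1 ∈ p.1 ↔ x.1 ∈ W (p.1 ∪ p.2) (p.1 ∩ p.2)) ↔ x.2 = false)
  have hφ : ∀ p x, x ∈ φ p ↔ (x.1 ∈ p.1 ∧ x.1 ∈ p.2) ∨ (x.1 ∈ p.1 ∨ x.1 ∈ p.2) ∧
      ((x.1 ∈ p.1 ↔ x.1 ∈ W (p.1 ∪ p.2) (p.1 ∩ p.2)) ↔ x.2 = false) := fun p x => by simp [φ]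
  rw [numIndepSets, sq, ← card_product]
  refine card_le_card_of_injOn φ ?_ ?_
  · rintro ⟨S, T⟩ h
    simp only [coe_product, Set.mem_prod, mem_coe, mem_filter, mem_univ, true_and] at h
    obtain ⟨hS, hT⟩ := h
    obtain ⟨hW1, hW2⟩ := hW _ _ S T hS hT rfl rfl
    simp only [mem_coe, mem_filter, mem_univ, true_and]
    rintro ⟨u, i⟩ hu ⟨v, j⟩ hv ⟨huv, hij⟩
    rw [hφ] at hu hv
    dsimp only at hu hv huv hij
    have hSS := fun h h' => hS u h v h' huv
    have hTT := fun h h' => hT u h v h' huv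
    have hWW := fun h h' => hW1 u h v h' huv
    have hWW' := fun h0 h h0' h' => hW2 u h0 h v h0' h' huv
    rw [mem_union] at hWW'
    rw [mem_union] at hWW'
    cases i <;> cases j <;> simp only [ne_eq, not_true_eq_false, reduceCtorEq] at hij hu hv <;> tauto
  · rintro ⟨S, T⟩ - ⟨S', T'⟩ - heq
    have hcore : ∀ {a b w a' b' w' : Prop},
        (∀ i, (a ∧ b) ∨ (a ∨ b) ∧ ((a ↔ w) ↔ i = false) ↔
          (a' ∧ b') ∨ (a' ∨ b') ∧ ((a' ↔ w') ↔ i = false)) →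
        ((a ∨ b ↔ a' ∨ b') ∧ (a ∧ b ↔ a' ∧ b')) ∧ ((w ↔ w') → (a ↔ a') ∧ (b ↔ b')) := by
      intro a b w a' b' w' h
      have h0 := h false
      have h1 := h true
      clear h hφ heq hW φ W indep
      by_cases a <;> by_cases b <;> by_cases a' <;> by_cases b' <;> by_cases w <;> by_cases w' <;>
        simp_all
    have hmem := fun v => hcore fun i => (hφ (S, T) (v, i)).symm.trans
      ((Finset.ext_iff.1 heq (v, i)).trans (hφ (S', T') (v, i)))
    have hU : S ∪ T = S' ∪ T' := Finset.ext fun v => by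
      rw [mem_union, mem_union]; exact (hmem v).1.1
    have hI : S ∩ T = S' ∩ T' := Finset.ext fun v => by
      rw [mem_inter, mem_inter]; exact (hmem v).1.2
    have hv := fun v => (hmem v).2 (by rw [hU, hI])
    exact Prod.ext (Finset.ext fun v => (hv v).1) (Finset.ext fun v => (hv v).2)

theorem indepBound_one_eq_prod_edgeWeight (hiso : ∀ v : V, 0 < G.degree v) :
    indepBound G (fun _ => 1) = ∏ e ∈ G.edgeFinset, edgeWeight G e := by
  have hw : ∀ u v, edgeWeight G s(u, v) = edgeFactor 1 1 (G.degree u) (G.degree v) := by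
    intro u v
    rw [edgeFactor, edgeWeight, Sym2.lift_mk, add_comm ((1 + 1) ^ G.degree v)]
    norm_num
  have hpos : ∀ e, 0 < edgeWeight G e := fun e => by
    induction e with
    | h u v => rw [hw]; exact edgeFactor_pos zero_le_one zero_le_one _ _
  have hsqrt : ∏ u, ∏ v, √(pairFactor G (fun _ => 1) u v) * √(pairFactor G (fun _ => 1) u v)
      = ∏ d : G.Dart, edgeWeight G d.edge := by
    rw [← Fintype.prod_prod_type']
    symm
    rw [← prod_filter_mul_prod_filter_not univ (fun x : V × V => G.Adj x.1 x.2), prod_eq_one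
      (s := univ.filter fun x : V × V => ¬ G.Adj x.1 x.2) fun x hx => ?_, mul_one]
    · refine prod_bij (fun d _ => d.toProd) (fun d _ => by simp)
        (fun d _ d' _ h => SimpleGraph.Dart.ext _ _ h)
        (fun x hx => ⟨⟨x, by simpa using hx⟩, mem_univ _, rfl⟩) fun d _ => ?_
      rw [Real.mul_self_sqrt (pairFactor_pos (fun _ => zero_le_one) _ _).le, pairFactor,
        if_pos d.adj, ← hw]
      rfl
    · rw [pairFactor, if_neg (by simpa using hx), Real.sqrt_one, one_mul]
  have hfib : ∏ d : G.Dart, edgeWeight G d.edge = ∏ e ∈ G.edgeFinset, edgeWeight G e ^ 2 := by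
    rw [← prod_fiberwise_of_maps_to (s := univ) (t := G.edgeFinset) (g := fun d : G.Dart => d.edge)
      fun d _ => by simp]
    refine prod_congr rfl fun e he => ?_
    rw [prod_eq_pow_card (b := edgeWeight G e) fun d hd => by rw [(mem_filter.1 hd).2],
      G.dart_edge_fiber_card e (by simpa using he)]
  have hnn : 0 ≤ ∏ u, ∏ v, √(pairFactor G (fun _ => 1) u v) :=
    prod_nonneg fun u _ => prod_nonneg fun v _ => Real.sqrt_nonneg _
  rw [indepBound, prod_eq_one fun u _ => by rw [isolatedFactor, if_neg (hiso u).ne'], one_mul]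
  refine (sq_eq_sq₀ hnn (prod_nonneg fun e _ => (hpos e).le)).1 ?_
  rw [← prod_pow (s := G.edgeFinset), ← hfib, ← hsqrt, sq, ← prod_mul_distrib]
  exact prod_congr rfl fun u _ => prod_mul_distrib.symm

end

theorem isDisjUnionCompleteBipartite_iff {V : Type*} [Fintype V] {G : SimpleGraph V} :
    IsDisjUnionCompleteBipartite G ↔
      ∀ a b c d, G.Adj a b → G.Adj b c → G.Adj c d → G.Adj a d := by
  constructor
  · intro h a b c d hab hbc hcd
    obtain ⟨m, n, ⟨φ⟩⟩ := h (G.connectedComponentMk a)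
    have hb := SimpleGraph.ConnectedComponent.eq.2 hab.symm.reachable
    have hc := (SimpleGraph.ConnectedComponent.eq.2 hbc.symm.reachable).trans hb
    have hd := (SimpleGraph.ConnectedComponent.eq.2 hcd.symm.reachable).trans hc
    have hadj : ∀ x y : {v | G.connectedComponentMk v = G.connectedComponentMk a},
        G.Adj x y ↔ (completeBipartiteGraph (Fin m) (Fin n)).Adj (φ x) (φ y) := fun x y =>
      φ.map_adj_iff.symm
    have hab' := (hadj ⟨a, rfl⟩ ⟨b, hb⟩).1 hab
    have hbc' := (hadj ⟨b, hb⟩ ⟨c, hc⟩).1 hbc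
    have hcd' := (hadj ⟨c, hc⟩ ⟨d, hd⟩).1 hcd
    refine (hadj ⟨a, rfl⟩ ⟨d, hd⟩).2 ?_
    revert hab' hbc' hcd'
    generalize φ ⟨a, rfl⟩ = a'
    generalize φ ⟨b, hb⟩ = b'
    generalize φ ⟨c, hc⟩ = c'
    generalize φ ⟨d, hd⟩ = d'
    rcases a' with _ | _ <;> rcases b' with _ | _ <;> rcases c' with _ | _ <;>
      rcases d' with _ | _ <;> simp
  · intro hcl C
    have htf : ∀ a b c, G.Adj a b → G.Adj b c → ¬ G.Adj a c := fun a b c hab hbc hac =>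
      G.irrefl (hcl a b c a hab hbc hac.symm)
    obtain ⟨v, rfl⟩ := C.exists_rep
    have hreach : ∀ {x}, G.Reachable x v → G.Adj v x ∨ x = v ∨ ∃ z, G.Adj v z ∧ G.Adj z x := by
      rintro x ⟨p⟩
      induction p with
      | nil => exact Or.inr (Or.inl rfl)
      | cons h p ih =>
        rcases ih with h' | rfl | ⟨z, hvz, hz⟩
        · exact Or.inr (Or.inr ⟨_, h', h.symm⟩)
        · exact Or.inl h.symm
        · exact Or.inl (hcl _ _ _ _ hvz hz h.symm)
    have hiff : ∀ {x y}, G.Reachable x v → G.Reachable y v →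
        (G.Adj x y ↔ (G.Adj v x ∧ ¬ G.Adj v y) ∨ (¬ G.Adj v x ∧ G.Adj v y)) := by
      have hjoin : ∀ {x y}, G.Reachable y v → G.Adj v x → ¬ G.Adj v y → G.Adj x y := by
        intro x y hy hvx hvy
        rcases hreach hy with h | rfl | ⟨z, hvz, hz⟩
        · exact absurd h hvy
        · exact hvx.symm
        · exact hcl _ _ _ _ hvx.symm hvz hz
      intro x y hx hy
      constructor
      · intro hxy
        by_cases hvx : G.Adj v x
        · exact Or.inl ⟨hvx, htf _ _ _ hvx hxy⟩
        · refine Or.inr ⟨hvx, ?_⟩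
          rcases hreach hx with h | rfl | ⟨z, hvz, hz⟩
          · exact absurd h hvx
          · exact hxy
          · exact hcl _ _ _ _ hvz hz hxy
      · rintro (⟨h, h'⟩ | ⟨h, h'⟩)
        · exact hjoin hy h h'
        · exact (hjoin hx h' h).symm
    let X := {x | G.connectedComponentMk x = G.connectedComponentMk v}
    let p : X → Prop := fun x => G.Adj v x
    let e : X ≃ Fin _ ⊕ Fin _ := (Equiv.sumCompl p).symm.trans
      (Equiv.sumCongr (Fintype.equivFin {x // p x}) (Fintype.equivFin {x // ¬ p x}))
    have hleft : ∀ x : X, (e x).isLeft = true ↔ G.Adj v x := fun x => by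
      by_cases h : p x
      · simp [e, Equiv.sumCompl_symm_apply_of_pos h, show G.Adj v x from h]
      · simp [e, Equiv.sumCompl_symm_apply_of_neg h, show ¬ G.Adj v x from h]
    refine ⟨_, _, ⟨⟨e, fun {x y} => ?_⟩⟩⟩
    rw [completeBipartiteGraph_adj, SimpleGraph.comap_adj]
    refine Iff.trans ?_ (hiff (SimpleGraph.ConnectedComponent.eq.1 x.2)
      (SimpleGraph.ConnectedComponent.eq.1 y.2)).symm
    rw [← hleft x, ← hleft y, Sum.not_isLeft, Sum.not_isLeft]
    exact Iff.rfl

/-- **Sah–Sawhney–Stoner–Zhao.** If `G` has no isolated vertices then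
`i(G) ≤ ∏_{uv ∈ E(G)} i(K_{d_u,d_v})^{1/(d_u d_v)}`, with equality iff `G` is a
disjoint union of complete bipartite graphs. -/
theorem independent_sets_upper_bound {V : Type*} [Fintype V] (G : SimpleGraph V)
    (hiso : ∀ v : V, 0 < G.degree v) :
    (numIndepSets G : ℝ) ≤ ∏ e ∈ G.edgeFinset, edgeWeight G e ∧
      ((numIndepSets G : ℝ) = ∏ e ∈ G.edgeFinset, edgeWeight G e ↔
        IsDisjUnionCompleteBipartite G) := by
  rw [← indepBound_one_eq_prod_edgeWeight hiso, isDisjUnionCompleteBipartite_iff]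
  have hone : ∀ {W : Type _} (_ : W), (0 : ℝ) ≤ 1 := fun _ => zero_le_one
  have hcover : indepSum G.doubleCover (fun _ => 1) ≤ indepBound G.doubleCover (fun _ => 1) :=
    indepSum_le_indepBound _ _ hone doubleCover_triangle_free
  have hsq : (numIndepSets G : ℝ) ^ 2 ≤ indepSum G.doubleCover (fun _ => 1) := by
    rw [indepSum_one]
    exact_mod_cast numIndepSets_sq_le
  have hnn : 0 ≤ indepBound G (fun _ => 1) :=
    mul_nonneg (prod_nonneg fun u _ => (isolatedFactor_pos hone u).le)
      (prod_nonneg fun u _ => prod_nonneg fun v _ => Real.sqrt_nonneg _)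
  refine ⟨?_, fun heq => ?_, fun hcl => ?_⟩
  · refine (sq_le_sq₀ (Nat.cast_nonneg _) hnn).1 ?_
    rw [← indepBound_doubleCover]
    exact hsq.trans hcover
  · rw [heq, ← indepBound_doubleCover] at hsq
    intro a b c d hab hbc hcd
    exact (adj_of_path_of_indepSum_eq _ _ hone (fun _ _ => rfl) doubleCover_triangle_free
      (le_antisymm hcover hsq) (a, false) (b, true) (c, false) (d, true)
      ⟨hab, by simp⟩ ⟨hbc, by simp⟩ ⟨hcd, by simp⟩).1
  · rw [← indepSum_one]
    exact indepSum_eq_indepBound_of_closed G _ hone hcl fun _ _ _ _ _ => rfl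
end

section
/- Let G be a finite simple graph with no isolated vertices, let d_v denote the degree of vertex v in G, and let λ > 0 be a real number. Then the independence polynomial satisfies P_G(λ) ≤ ∏_{uv ∈ E(G)} P_{K_{d_u,d_v}}(λ)^{1/(d_u d_v)}, where the product is over the edges of G. -/
open Finset
open scoped Classical

/-- The independence polynomial (hard-core partition function)
`P_G(x) = ∑_{I ∈ I(G)} x^{|I|}` of a finite simple graph `G`. -/
noncomputable def indepPoly {V : Type*} [Fintype V] (G : SimpleGraph V) (x : ℝ) : ℝ :=
  ∑ S ∈ Finset.univ.filter (fun S : Finset V => ∀ u ∈ S, ∀ v ∈ S, ¬ G.Adj u v), x ^ S.card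

/-- The independence polynomial is invariant under graph isomorphism. -/
lemma indepPoly_iso {V W : Type*} [Fintype V] [Fintype W] {G : SimpleGraph V}
    {H : SimpleGraph W} (e : G ≃g H) (x : ℝ) : indepPoly G x = indepPoly H x := by
  unfold indepPoly
  apply Finset.sum_equiv (Equiv.finsetCongr e.toEquiv)
  · intro S
    simp only [mem_filter, mem_univ, true_and, Equiv.finsetCongr_apply]
    constructor
    · intro h u hu v hv
      simp only [Finset.mem_map, Equiv.coe_toEmbedding] at hu hv
      obtain ⟨a, ha, rfl⟩ := hu
      obtain ⟨b, hb, rfl⟩ := hv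
      intro hadj
      exact h a ha b hb (e.map_adj_iff.mp hadj)
    · intro h u hu v hv hadj
      refine h (e.toEquiv u) ?_ (e.toEquiv v) ?_ (e.map_adj_iff.mpr hadj)
      · simp only [Finset.mem_map, Equiv.coe_toEmbedding]
        exact ⟨u, hu, rfl⟩
      · simp only [Finset.mem_map, Equiv.coe_toEmbedding]
        exact ⟨v, hv, rfl⟩
  · intro S hS
    simp

/-- The complete bipartite graph is symmetric in its two parts. -/
def cbgComm (α β : Type*) : completeBipartiteGraph α β ≃g completeBipartiteGraph β α :=
  ⟨Equiv.sumComm α β, by rintro (a|a) (b|b) <;> simp [completeBipartiteGraph]⟩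

/-- The weight `P_{K_{d_u,d_v}}(x)^{1/(d_u d_v)}` attached to the edge `uv`,
as a symmetric function on `Sym2 V`. -/
noncomputable def edgeWeightP {V : Type*} [Fintype V] (G : SimpleGraph V) (x : ℝ) :
    Sym2 V → ℝ :=
  Sym2.lift ⟨fun u v =>
      (indepPoly (completeBipartiteGraph (Fin (G.degree u)) (Fin (G.degree v))) x) ^
        ((1:ℝ) / ((G.degree u : ℝ) * (G.degree v : ℝ))),
    fun u v => by
      simp only []
      rw [indepPoly_iso (cbgComm (Fin (G.degree u)) (Fin (G.degree v))) x,
        mul_comm ((G.degree u : ℝ))]⟩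

lemma monotone_deriv_log_one_add_exp_rpow_sub_one {p : ℝ} (hp : 1 ≤ p) :
    Monotone fun θ : ℝ => p * (1 + Real.exp θ) ^ (p - 1) * Real.exp θ /
      ((1 + Real.exp θ) ^ p - 1) := by
  have key : ∀ θ : ℝ, p * (1 + Real.exp θ) ^ (p - 1) * Real.exp θ /
      ((1 + Real.exp θ) ^ p - 1) =
      p * ((((1 + Real.exp θ)⁻¹) ^ p - 1) / ((1 + Real.exp θ)⁻¹ - 1))⁻¹ := by
    intro θ
    have h0 := Real.exp_pos θ
    have h1 : (1 + Real.exp θ) ^ p = (1 + Real.exp θ) ^ (p - 1) * (1 + Real.exp θ) := by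
      rw [← Real.rpow_add_one (by positivity)]; ring_nf
    have h2 : 1 < (1 + Real.exp θ) ^ p := Real.one_lt_rpow (by linarith) (by linarith)
    have h3 : 0 < (1 + Real.exp θ) ^ (p - 1) := by positivity
    rw [Real.inv_rpow (by positivity)]
    have h4 : (1 + Real.exp θ)⁻¹ - 1 ≠ 0 := by
      have : (1 + Real.exp θ)⁻¹ < 1 := inv_lt_one_of_one_lt₀ (by linarith)
      linarith
    have h5 : ((1 + Real.exp θ) ^ p)⁻¹ - 1 ≠ 0 := by
      have : ((1 + Real.exp θ) ^ p)⁻¹ < 1 := inv_lt_one_of_one_lt₀ h2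
      linarith
    have h6 : (1 + Real.exp θ) ^ p - 1 ≠ 0 := by linarith
    rw [inv_div, mul_assoc, mul_div_assoc, mul_right_inj' (by linarith), div_eq_div_iff h6 h5]
    generalize (1 + Real.exp θ) ^ (p - 1) = z at *
    rw [h1] at *
    field_simp
    ring
  intro θ₁ θ₂ h
  simp only [key]
  have hq : ∀ θ : ℝ, (1 + Real.exp θ)⁻¹ < 1 ∧ 0 < (1 + Real.exp θ)⁻¹ := fun θ =>
    ⟨inv_lt_one_of_one_lt₀ (by linarith [Real.exp_pos θ]), by positivity⟩
  have hle : (1 + Real.exp θ₂)⁻¹ ≤ (1 + Real.exp θ₁)⁻¹ := by gcongr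
  have := (convexOn_rpow hp).secant_mono (a := 1) (x := (1 + Real.exp θ₂)⁻¹)
    (y := (1 + Real.exp θ₁)⁻¹) (by simp) (hq θ₂).2.le (hq θ₁).2.le
    (hq θ₂).1.ne (hq θ₁).1.ne hle
  simp only [Real.one_rpow] at this
  have hpos : 0 < (((1 + Real.exp θ₂)⁻¹) ^ p - 1) / ((1 + Real.exp θ₂)⁻¹ - 1) := by
    apply div_pos_of_neg_of_neg
    · linarith [Real.rpow_lt_one (hq θ₂).2.le (hq θ₂).1 (by linarith : 0 < p)]
    · linarith [(hq θ₂).1]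
  gcongr

lemma convexOn_log_one_add_exp_rpow_sub_one {p : ℝ} (hp : 1 ≤ p) :
    ConvexOn ℝ Set.univ fun θ : ℝ => Real.log ((1 + Real.exp θ) ^ p - 1) := by
  have hd : ∀ θ : ℝ, HasDerivAt (fun θ : ℝ => Real.log ((1 + Real.exp θ) ^ p - 1))
      (p * (1 + Real.exp θ) ^ (p - 1) * Real.exp θ / ((1 + Real.exp θ) ^ p - 1)) θ := by
    intro θ
    have h0 := Real.exp_pos θ
    have h2 : 1 < (1 + Real.exp θ) ^ p := Real.one_lt_rpow (by linarith) (by linarith)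
    have := ((((Real.hasDerivAt_exp θ).const_add 1).rpow_const (p := p)
      (Or.inr hp)).sub_const 1).log (by linarith)
    convert this using 1
    ring
  apply Monotone.convexOn_univ_of_deriv
  · exact fun θ => (hd θ).differentiableAt
  · have : deriv (fun θ : ℝ => Real.log ((1 + Real.exp θ) ^ p - 1)) = _ :=
      funext fun θ => (hd θ).deriv
    rw [this]
    exact monotone_deriv_log_one_add_exp_rpow_sub_one hp

/-- Log-convexity of `u ↦ (1 + u) ^ p - 1` in the variable `log u`. -/
lemma one_add_rpow_sub_one_le {p u v : ℝ} (hp : 1 ≤ p) (hu : 0 < u) (hv : 0 < v)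
    {a b : ℝ} (ha : 0 ≤ a) (hb : 0 ≤ b) (hab : a + b = 1) :
    (1 + u ^ a * v ^ b) ^ p - 1 ≤ ((1 + u) ^ p - 1) ^ a * ((1 + v) ^ p - 1) ^ b := by
  have h := (convexOn_log_one_add_exp_rpow_sub_one hp).2 (Set.mem_univ (Real.log u))
    (Set.mem_univ (Real.log v)) ha hb hab
  have e : Real.exp (a * Real.log u + b * Real.log v) = u ^ a * v ^ b := by
    rw [Real.exp_add, Real.rpow_def_of_pos hu, Real.rpow_def_of_pos hv]
    ring_nf
  simp only [smul_eq_mul, e, Real.exp_log hu, Real.exp_log hv] at h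
  have hpos : ∀ z : ℝ, 0 < z → 0 < (1 + z) ^ p - 1 := fun z hz => by
    linarith [Real.one_lt_rpow (by linarith : 1 < 1 + z) (by linarith : 0 < p)]
  have h3 := hpos (u ^ a * v ^ b) (by positivity)
  rw [Real.rpow_def_of_pos (hpos u hu), Real.rpow_def_of_pos (hpos v hv), ← Real.exp_add,
    ← Real.log_le_iff_le_exp h3]
  linarith

/-- Hölder's inequality for two terms. -/
lemma rpow_mul_rpow_add_le {a₁ a₂ b₁ b₂ α β : ℝ} (ha₁ : 0 < a₁) (ha₂ : 0 ≤ a₂) (hb₁ : 0 < b₁)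
    (hb₂ : 0 ≤ b₂) (hα : 0 ≤ α) (hβ : 0 ≤ β) (h : α + β = 1) :
    a₁ ^ α * b₁ ^ β + a₂ ^ α * b₂ ^ β ≤ (a₁ + a₂) ^ α * (b₁ + b₂) ^ β := by
  have hA : 0 < a₁ + a₂ := by positivity
  have hB : 0 < b₁ + b₂ := by positivity
  have h1 := Real.geom_mean_le_arith_mean2_weighted hα hβ (div_nonneg ha₁.le hA.le)
    (div_nonneg hb₁.le hB.le) h
  have h2 := Real.geom_mean_le_arith_mean2_weighted hα hβ (div_nonneg ha₂ hA.le)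
    (div_nonneg hb₂ hB.le) h
  rw [Real.div_rpow, Real.div_rpow, div_mul_div_comm] at h1 h2 <;> try positivity
  have h3 : α * (a₁ / (a₁ + a₂)) + β * (b₁ / (b₁ + b₂)) +
      (α * (a₂ / (a₁ + a₂)) + β * (b₂ / (b₁ + b₂))) = 1 := by
    rw [← h]; field_simp; ring
  have h4 := add_le_add h1 h2
  rw [h3, ← add_div, div_le_one (by positivity)] at h4
  exact h4

lemma add_pow_rpow_add_le {k : ℕ} {p s t x : ℝ} (hp : 1 ≤ p) (hs : 0 ≤ s)
    (ht : 1 ≤ t) (hx : 1 ≤ x) :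
    (s + t ^ k) ^ p + (x - 1) * (t ^ k) ^ p ≤
      (s + t ^ (k + 1)) ^ (p * (k / (k + 1))) *
        ((1 + s) ^ p - 1 + x ^ (k + 1)) ^ (1 / ((k : ℝ) + 1)) := by
  have ht0 : 0 < t := by linarith
  have hx0 : 0 < x := by linarith
  have hk : (0 : ℝ) < k + 1 := by positivity
  set α : ℝ := k / (k + 1) with hα
  set β : ℝ := 1 / ((k : ℝ) + 1) with hβ
  have hαβ : α + β = 1 := by rw [hα, hβ]; field_simp
  have hα0 : 0 ≤ α := by positivity
  have hβ0 : 0 ≤ β := by positivity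
  have hone : ∀ z : ℝ, 0 ≤ z → 0 ≤ (1 + z) ^ p - 1 := fun z hz => by
    linarith [Real.one_le_rpow (by linarith : 1 ≤ 1 + z) (by linarith : 0 ≤ p)]
  have hxp : (x ^ (k + 1)) ^ β = x := by
    rw [hβ, ← Real.rpow_natCast, ← Real.rpow_mul hx0.le]; push_cast
    rw [mul_one_div_cancel hk.ne', Real.rpow_one]
  have htp : (t ^ (k + 1)) ^ α = t ^ k := by
    rw [hα, ← Real.rpow_natCast, ← Real.rpow_mul ht0.le]; push_cast
    rw [mul_div_cancel₀ _ hk.ne', Real.rpow_natCast]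
  have hconv : (1 + s / t ^ k) ^ p - 1 ≤
      ((1 + s / t ^ (k + 1)) ^ p - 1) ^ α * ((1 + s) ^ p - 1) ^ β := by
    rcases hs.eq_or_lt with rfl | hs
    · simp only [zero_div, add_zero, Real.one_rpow, sub_self]
      positivity
    · have := one_add_rpow_sub_one_le hp (u := s / t ^ (k + 1)) (v := s) (by positivity) hs
        hα0 hβ0 hαβ
      rwa [Real.div_rpow hs.le (by positivity), htp, div_mul_eq_mul_div, ← Real.rpow_add hs,
        hαβ, Real.rpow_one] at this
  have hH := rpow_mul_rpow_add_le (a₁ := 1) (a₂ := (1 + s / t ^ (k + 1)) ^ p - 1)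
    (b₁ := x ^ (k + 1)) (b₂ := (1 + s) ^ p - 1) one_pos (hone _ (by positivity)) (by positivity)
    (hone _ hs) hα0 hβ0 hαβ
  rw [hxp, Real.one_rpow, one_mul, add_sub_cancel] at hH
  have hmain : (1 + s / t ^ k) ^ p + (x - 1) ≤
      ((1 + s / t ^ (k + 1)) ^ p) ^ α * ((1 + s) ^ p - 1 + x ^ (k + 1)) ^ β := by
    rw [add_comm ((1 + s) ^ p - 1)]
    linarith
  have e1 : s + t ^ k = t ^ k * (1 + s / t ^ k) := by field_simp; ring
  have e2 : s + t ^ (k + 1) = t ^ (k + 1) * (1 + s / t ^ (k + 1)) := by field_simp; ring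
  rw [Real.rpow_mul (by positivity), e1, e2, Real.mul_rpow (by positivity) (by positivity),
    Real.mul_rpow (by positivity) (by positivity), Real.mul_rpow (by positivity) (by positivity)]
  have e3 : ((t ^ (k + 1)) ^ p) ^ α = (t ^ k) ^ p := by
    rw [← Real.rpow_mul (by positivity), mul_comm, Real.rpow_mul (by positivity), htp]
  rw [e3, mul_assoc]
  have h0 : 0 ≤ (t ^ k) ^ p := by positivity
  nlinarith [mul_le_mul_of_nonneg_left hmain h0]

/-- A form of Hölder's inequality for two products. -/
lemma prod_add_mul_prod_le_prod {ι : Type*} {s : Finset ι} (hs : s.Nonempty) {A B T : ι → ℝ}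
    {c : ℝ} (hc : 0 ≤ c) (hA : ∀ i ∈ s, 0 ≤ A i) (hB : ∀ i ∈ s, 0 ≤ B i) (hT : ∀ i ∈ s, 0 < T i)
    (h : ∀ i ∈ s, A i ^ s.card + c * B i ^ s.card ≤ T i ^ s.card) :
    ∏ i ∈ s, A i + c * ∏ i ∈ s, B i ≤ ∏ i ∈ s, T i := by
  have hn : (0 : ℝ) < s.card := by exact_mod_cast hs.card_pos
  have amgm : ∀ F : ι → ℝ, (∀ i ∈ s, 0 ≤ F i) →
      ∏ i ∈ s, F i ≤ ∑ i ∈ s, (s.card : ℝ)⁻¹ * F i ^ s.card := by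
    intro F hF
    have := Real.geom_mean_le_arith_mean_weighted s (fun _ => (s.card : ℝ)⁻¹)
      (fun i => F i ^ s.card) (fun _ _ => by positivity) (by simp [hn.ne'])
      (fun i hi => pow_nonneg (hF i hi) _)
    refine le_trans (le_of_eq ?_) this
    refine prod_congr rfl fun i hi => ?_
    rw [Real.pow_rpow_inv_natCast (hF i hi) hs.card_pos.ne']
  have h1 := amgm (fun i => A i / T i) fun i hi => div_nonneg (hA i hi) (hT i hi).le
  have h2 := mul_le_mul_of_nonneg_left
    (amgm (fun i => B i / T i) fun i hi => div_nonneg (hB i hi) (hT i hi).le) hc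
  have hP : 0 < ∏ i ∈ s, T i := prod_pos hT
  have h3 : ∑ i ∈ s, (s.card : ℝ)⁻¹ * (A i / T i) ^ s.card +
      c * ∑ i ∈ s, (s.card : ℝ)⁻¹ * (B i / T i) ^ s.card ≤ ∑ i ∈ s, (s.card : ℝ)⁻¹ := by
    rw [mul_sum, ← sum_add_distrib]
    refine sum_le_sum fun i hi => ?_
    have hTi := pow_pos (hT i hi) s.card
    rw [div_pow, div_pow]
    calc _ = (s.card : ℝ)⁻¹ * ((A i ^ s.card + c * B i ^ s.card) / T i ^ s.card) := by ring
      _ ≤ (s.card : ℝ)⁻¹ * 1 := by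
        gcongr
        exact (div_le_one hTi).2 (h i hi)
      _ = _ := mul_one _
  have h4 : ∑ i ∈ s, (s.card : ℝ)⁻¹ = 1 := by simp [hn.ne']
  have h5 := (add_le_add h1 h2).trans (h3.trans_eq h4)
  rw [prod_div_distrib, prod_div_distrib, ← mul_div_assoc, ← add_div, div_le_one hP] at h5
  exact h5

/-- `P_{K_{m,n}}(s, t) ^ (1 / (m n))` for a vertex of degree `m` and fugacity `s` joined to a vertex
of degree `n` and fugacity `t`. -/
noncomputable def bipWeight (m n : ℕ) (s t : ℝ) : ℝ :=
  ((1 + s) ^ n + (1 + t) ^ m - 1) ^ ((1 : ℝ) / (m * n))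

lemma one_le_bipWeight_base (m n : ℕ) {s t : ℝ} (hs : 0 ≤ s) (ht : 0 ≤ t) :
    1 ≤ (1 + s) ^ n + (1 + t) ^ m - 1 := by
  have h1 : 1 ≤ (1 + s) ^ n := one_le_pow₀ (by linarith)
  have h2 : 1 ≤ (1 + t) ^ m := one_le_pow₀ (by linarith)
  linarith

lemma bipWeight_pos (m n : ℕ) {s t : ℝ} (hs : 0 ≤ s) (ht : 0 ≤ t) : 0 < bipWeight m n s t :=
  Real.rpow_pos_of_pos (one_pos.trans_le (one_le_bipWeight_base m n hs ht)) _

lemma bipWeight_pow (m n q : ℕ) {s t : ℝ} (hs : 0 ≤ s) (ht : 0 ≤ t) :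
    bipWeight m n s t ^ q = ((1 + s) ^ n + (1 + t) ^ m - 1) ^ ((q : ℝ) / (m * n)) := by
  rw [bipWeight, ← Real.rpow_natCast, ← Real.rpow_mul
    (one_pos.trans_le (one_le_bipWeight_base m n hs ht)).le]
  congr 1
  ring

lemma bipWeight_pow_add_le {k n N : ℕ} (hk : k ≠ 0) (hn : 0 < n) (hnN : n ≤ N) {s t l : ℝ}
    (hs : 0 ≤ s) (ht : 0 ≤ t) (hl : 0 ≤ l) :
    (bipWeight k n s t ^ N) ^ k + l * (bipWeight k n 0 t ^ N) ^ k ≤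
      (bipWeight (k + 1) n s t ^ N) ^ k * bipWeight (k + 1) N s l ^ N := by
  have hN : 0 < N := hn.trans_le hnN
  have hkR : (k : ℝ) ≠ 0 := by exact_mod_cast hk
  have hnR : (0 : ℝ) < n := by exact_mod_cast hn
  have hNR : (N : ℝ) ≠ 0 := by exact_mod_cast hN.ne'
  have hp : (1 : ℝ) ≤ N / n := by rw [le_div_iff₀ hnR, one_mul]; exact_mod_cast hnN
  have h := add_pow_rpow_add_le (k := k) hp (s := (1 + s) ^ n - 1) (t := 1 + t) (x := 1 + l)
    (by linarith [one_le_pow₀ (n := n) (by linarith : 1 ≤ 1 + s)]) (by linarith) (by linarith)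
  have e1 : (1 + ((1 + s) ^ n - 1)) ^ ((N : ℝ) / n) = (1 + s) ^ N := by
    rw [add_sub_cancel, ← Real.rpow_natCast, ← Real.rpow_mul (by linarith),
      mul_div_cancel₀ _ hnR.ne', Real.rpow_natCast]
  rw [e1] at h
  simp only [← pow_mul]
  rw [bipWeight_pow _ _ _ hs ht, bipWeight_pow _ _ _ le_rfl ht, bipWeight_pow _ _ _ hs ht,
    bipWeight_pow _ _ _ hs hl]
  have e2 : ((N * k : ℕ) : ℝ) / (k * n) = N / n := by push_cast; field_simp
  have e3 : ((N * k : ℕ) : ℝ) / ((k + 1 : ℕ) * n) = N / n * (k / (k + 1)) := by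
    push_cast; field_simp
  have e4 : (N : ℝ) / ((k + 1 : ℕ) * N) = 1 / (k + 1) := by push_cast; field_simp
  rw [e2, e3, e4]
  convert h using 3 <;> ring_nf

lemma prod_bipWeight_pow_add_le {B : Type*} (s : Finset B) {D : B → ℕ} {N : ℕ} {g : B → ℝ}
    {y l : ℝ} (hN : 0 < N) (hD : ∀ b ∈ s, 0 < D b) (hDN : ∀ b ∈ s, D b ≤ N) (hg : ∀ b, 0 ≤ g b)
    (hy : 0 ≤ y) (hl : 0 ≤ l) :
    ((if #s = 0 then 1 + y else 1) * ∏ b ∈ s, bipWeight #s (D b) y (g b)) ^ N +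
      l * ((if #s = 0 then 1 + 0 else 1) * ∏ b ∈ s, bipWeight #s (D b) 0 (g b)) ^ N ≤
    (bipWeight (#s + 1) N y l * ∏ b ∈ s, bipWeight (#s + 1) (D b) y (g b)) ^ N := by
  rcases s.eq_empty_or_nonempty with rfl | hs
  · have hNR : (N : ℝ) ≠ 0 := by exact_mod_cast hN.ne'
    simp only [card_empty, if_true, prod_empty, mul_one, zero_add, bipWeight_pow _ _ _ hy hl]
    simp [hNR]
    linarith
  · have hc : #s ≠ 0 := hs.card_pos.ne'
    have hr := pow_pos (bipWeight_pos (#s + 1) N hy hl) N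
    have h := prod_add_mul_prod_le_prod hs hl
      (A := fun b => bipWeight #s (D b) y (g b) ^ N) (B := fun b => bipWeight #s (D b) 0 (g b) ^ N)
      (T := fun b => bipWeight (#s + 1) (D b) y (g b) ^ N *
        (bipWeight (#s + 1) N y l ^ N) ^ ((#s : ℝ)⁻¹))
      (fun b _ => (pow_pos (bipWeight_pos _ _ hy (hg b)) _).le)
      (fun b _ => (pow_pos (bipWeight_pos _ _ le_rfl (hg b)) _).le)
      (fun b _ => mul_pos (pow_pos (bipWeight_pos _ _ hy (hg b)) _) (Real.rpow_pos_of_pos hr _))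
      (fun b hb => by
        rw [mul_pow, Real.rpow_inv_natCast_pow hr.le hc]
        exact bipWeight_pow_add_le hc (hD b hb) (hDN b hb) hy (hg b) hl)
    rw [prod_mul_distrib, prod_const, Real.rpow_inv_natCast_pow hr.le hc] at h
    simp only [hc, if_false, one_mul, mul_pow, ← prod_pow]
    linarith

section Bipartite

variable {A B : Type*} [Fintype A] [Fintype B]

/-- The multivariate independence polynomial of the bipartite graph with parts `A`, `B` and
adjacency relation `R`, summed over the part of the independent set lying in `B`. -/
noncomputable def bipPoly (R : A → B → Prop) (f : A → ℝ) (g : B → ℝ) : ℝ :=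
  ∑ S : Finset A, (∏ a ∈ S, f a) * ∏ b, if ∀ a ∈ S, ¬ R a b then 1 + g b else 1

/-- The relation `R` with all edges at `w` removed. -/
def deleteRight {A B : Type*} (R : A → B → Prop) (w : B) (a : A) (b : B) : Prop :=
  R a b ∧ b ≠ w

/-- The contribution of `a` and of the edges at `a` to the upper bound for `bipPoly`. -/
noncomputable def vertexBound (R : A → B → Prop) (f : A → ℝ) (g : B → ℝ) (a : A) : ℝ :=
  (if #{b | R a b} = 0 then 1 + f a else 1) *
    ∏ b with R a b, bipWeight #{b | R a b} #{a | R a b} (f a) (g b)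

lemma vertexBound_pos {R : A → B → Prop} {f : A → ℝ} {g : B → ℝ} (hf : ∀ a, 0 ≤ f a)
    (hg : ∀ b, 0 ≤ g b) (a : A) : 0 < vertexBound R f g a := by
  refine mul_pos ?_ (prod_pos fun b _ => bipWeight_pos _ _ (hf a) (hg b))
  split_ifs
  · linarith [hf a]
  · exact one_pos

lemma bipPoly_eq_add (R : A → B → Prop) (f : A → ℝ) (g : B → ℝ) (w : B) :
    bipPoly R f g =
      bipPoly (deleteRight R w) f (Function.update g w 0) +
      g w * bipPoly (deleteRight R w) (fun a => if R a w then 0 else f a)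
        (Function.update g w 0) := by
  unfold bipPoly
  rw [mul_sum, ← sum_add_distrib]
  refine sum_congr rfl fun S _ => ?_
  rw [← mul_prod_erase univ _ (mem_univ w),
    ← mul_prod_erase univ (fun b => if ∀ a ∈ S, ¬ deleteRight R w a b then
      1 + Function.update g w 0 b else 1) (mem_univ w)]
  have h1 : ∏ b ∈ univ.erase w, (if ∀ a ∈ S, ¬ deleteRight R w a b then
      1 + Function.update g w 0 b else 1) =
      ∏ b ∈ univ.erase w, (if ∀ a ∈ S, ¬ R a b then 1 + g b else 1) := by
    refine prod_congr rfl fun b hb => ?_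
    have hb : b ≠ w := ne_of_mem_erase hb
    simp [deleteRight, hb]
  rw [h1]
  have h2 : ∏ a ∈ S, (if R a w then 0 else f a) =
      if ∀ a ∈ S, ¬ R a w then ∏ a ∈ S, f a else 0 := by
    split_ifs with h
    · exact prod_congr rfl fun a ha => if_neg (h a ha)
    · push Not at h
      obtain ⟨a, ha, haw⟩ := h
      exact prod_eq_zero ha (if_pos haw)
  rw [h2]
  simp only [deleteRight, ne_eq, not_true_eq_false, and_false, not_false_eq_true,
    implies_true, if_true, Function.update_self, add_zero, one_mul]
  split_ifs <;> ring

lemma bipPoly_of_forall_not {R : A → B → Prop} (hR : ∀ a b, ¬ R a b) (f : A → ℝ) (g : B → ℝ) :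
    bipPoly R f g = (∏ a, (1 + f a)) * ∏ b, (1 + g b) := by
  simp [bipPoly, hR, prod_one_add, sum_mul]

lemma prod_vertexBound_add_le {R : A → B → Prop} {f : A → ℝ} {g : B → ℝ} {w : B}
    (hf : ∀ a, 0 ≤ f a) (hg : ∀ b, 0 ≤ g b) (hw : 0 < #{a | R a w})
    (hmax : ∀ b, #{a | R a b} ≤ #{a | R a w}) :
    ∏ a, vertexBound (deleteRight R w) f (Function.update g w 0) a +
      g w * ∏ a, vertexBound (deleteRight R w) (fun a => if R a w then 0 else f a)
        (Function.update g w 0) a ≤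
    ∏ a, vertexBound R f g a := by
  have hf' : ∀ a, 0 ≤ if R a w then 0 else f a := fun a => by split_ifs; exacts [le_rfl, hf a]
  have hg' : ∀ b, 0 ≤ Function.update g w 0 b := fun b => by
    rcases eq_or_ne b w with rfl | hb <;> simp [*]
  have hdeg : ∀ b, b ≠ w → #{a | deleteRight R w a b} = #{a | R a b} := fun b hb => by
    simp [deleteRight, hb]
  have hloc : ∀ (F : A → ℝ) (a : A),
      vertexBound (deleteRight R w) F (Function.update g w 0) a =
      (if #(({b | R a b} : Finset B).erase w) = 0 then 1 + F a else 1) *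
        ∏ b ∈ ({b | R a b} : Finset B).erase w,
          bipWeight #(({b | R a b} : Finset B).erase w) #{a | R a b} (F a) (g b) := by
    intro F a
    have hN : ({b | deleteRight R w a b} : Finset B) = ({b | R a b} : Finset B).erase w := by
      ext b
      rw [mem_filter, mem_erase, mem_filter]
      simp [deleteRight, and_comm]
    unfold vertexBound
    rw [hN]
    congr 1
    refine prod_congr rfl fun b hb => ?_
    have hb : b ≠ w := ne_of_mem_erase hb
    rw [hdeg b hb, Function.update_of_ne hb]
  rw [← prod_filter_mul_prod_filter_not univ (fun a => R a w) (vertexBound R f g),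
    ← prod_filter_mul_prod_filter_not univ (fun a => R a w) (vertexBound _ f _),
    ← prod_filter_mul_prod_filter_not univ (fun a => R a w)
      (vertexBound _ (fun a => if R a w then 0 else f a) _), ← mul_assoc]
  have hfar : ∀ F : A → ℝ, (∀ a, ¬ R a w → F a = f a) →
      ∏ a with ¬ R a w, vertexBound (deleteRight R w) F (Function.update g w 0) a =
      ∏ a with ¬ R a w, vertexBound R f g a := by
    intro F hF
    refine prod_congr rfl fun a ha => ?_
    have ha : ¬ R a w := (mem_filter.1 ha).2
    rw [hloc, hF a ha, erase_eq_of_notMem (by simpa using ha), vertexBound]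
  rw [hfar f fun _ _ => rfl, hfar _ fun a ha => if_neg ha, ← add_mul]
  refine mul_le_mul_of_nonneg_right ?_ (prod_nonneg fun a _ => (vertexBound_pos hf hg a).le)
  refine prod_add_mul_prod_le_prod (card_pos.1 hw) (hg w)
    (fun a _ => (vertexBound_pos hf hg' a).le) (fun a _ => (vertexBound_pos hf' hg' a).le)
    (fun a _ => vertexBound_pos hf hg a) fun a ha => ?_
  have ha : R a w := (mem_filter.1 ha).2
  have hmem : w ∈ ({b | R a b} : Finset B) := by simpa using ha
  have h := prod_bipWeight_pow_add_le (({b | R a b} : Finset B).erase w)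
    (D := fun b => #{a | R a b}) hw
    (fun b hb => card_pos.2 ⟨a, by simpa using (mem_erase.1 hb).2⟩) (fun b _ => hmax b) hg
    (hf a) (hg w)
  rw [hloc, hloc, if_pos ha]
  refine h.trans_eq ?_
  rw [card_erase_add_one hmem, vertexBound, if_neg (card_pos.2 ⟨w, hmem⟩).ne', one_mul,
    mul_prod_erase _ (fun b => bipWeight #{b | R a b} #{a | R a b} (f a) (g b)) hmem]

/-- Upper bound for the multivariate independence polynomial of a bipartite graph. -/
theorem bipPoly_le (R : A → B → Prop) (f : A → ℝ) (g : B → ℝ) (hf : ∀ a, 0 ≤ f a)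
    (hg : ∀ b, 0 ≤ g b) :
    bipPoly R f g ≤
      (∏ a, vertexBound R f g a) * ∏ b, if #{a | R a b} = 0 then 1 + g b else 1 := by
  induction hn : #{b | ∃ a, R a b} using Nat.strong_induction_on generalizing R f g with
  | _ n ih =>
  by_cases hR : ∀ a b, ¬ R a b
  · rw [bipPoly_of_forall_not hR]
    simp [vertexBound, hR]
  · push Not at hR
    obtain ⟨a₀, b₀, h₀⟩ := hR
    obtain ⟨w, -, hmax⟩ := exists_max_image univ (fun b => #{a | R a b}) ⟨b₀, mem_univ _⟩
    have hw : 0 < #{a | R a w} :=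
      (card_pos.2 ⟨a₀, by simpa using h₀⟩).trans_le (hmax b₀ (mem_univ _))
    obtain ⟨a₁, h₁⟩ := card_pos.1 hw
    have h₁ : R a₁ w := (mem_filter.1 h₁).2
    have hlt : #{b | ∃ a, deleteRight R w a b} < n := by
      rw [← hn]
      refine card_lt_card ⟨fun b hb => ?_, fun h => ?_⟩
      · obtain ⟨a, ha, -⟩ := (mem_filter.1 hb).2
        exact mem_filter.2 ⟨mem_univ _, a, ha⟩
      · have : w ∈ ({b | ∃ a, deleteRight R w a b} : Finset B) := h (by simpa using ⟨a₁, h₁⟩)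
        simp [deleteRight] at this
    have hf' : ∀ a, 0 ≤ if R a w then 0 else f a := fun a => by split_ifs; exacts [le_rfl, hf a]
    have hg' : ∀ b, 0 ≤ Function.update g w 0 b := fun b => by
      rcases eq_or_ne b w with rfl | hb <;> simp [*]
    have h1 := ih _ hlt (deleteRight R w) f (Function.update g w 0) hf hg' rfl
    have h2 := ih _ hlt (deleteRight R w) _ (Function.update g w 0) hf' hg' rfl
    have hI : (∏ b, if #{a | deleteRight R w a b} = 0 then 1 + Function.update g w 0 b else 1) =
        ∏ b, if #{a | R a b} = 0 then 1 + g b else 1 := by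
      refine prod_congr rfl fun b _ => ?_
      rcases eq_or_ne b w with rfl | hb
      · rw [if_neg hw.ne']; simp [deleteRight]
      · simp [deleteRight, hb]
    rw [hI] at h1 h2
    rw [bipPoly_eq_add R f g w]
    calc _ ≤ _ := add_le_add h1 (mul_le_mul_of_nonneg_left h2 (hg w))
      _ = _ := by rw [← mul_assoc, ← add_mul]
      _ ≤ _ := mul_le_mul_of_nonneg_right
        (prod_vertexBound_add_le hf hg hw fun b => hmax b (mem_univ _))
        (prod_nonneg fun b _ => by split_ifs <;> linarith [hg b])

end Bipartite

lemma sum_pow_card_univ {α : Type*} [Fintype α] (x : ℝ) :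
    ∑ S : Finset α, x ^ #S = (1 + x) ^ Fintype.card α := by
  have := prod_one_add (f := fun _ : α => x) univ
  simpa using this.symm

lemma indepPoly_completeBipartiteGraph {α β : Type*} [Fintype α] [Fintype β] (x : ℝ) :
    indepPoly (completeBipartiteGraph α β) x =
      (1 + x) ^ Fintype.card β + (1 + x) ^ Fintype.card α - 1 := by
  have h : ∀ p : Finset α × Finset β,
      (∀ u ∈ p.1.disjSum p.2, ∀ v ∈ p.1.disjSum p.2, ¬ (completeBipartiteGraph α β).Adj u v) ↔
        (p.1 = ∅ ∨ p.2 = ∅) := by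
    rintro ⟨S, T⟩
    simp only [completeBipartiteGraph, eq_empty_iff_forall_notMem, Sum.forall,
      inl_mem_disjSum, inr_mem_disjSum]
    simp
    by_cases hS : ∃ a, a ∈ S
    · obtain ⟨a, ha⟩ := hS
      constructor
      · rintro ⟨h, -⟩
        exact Or.inr (h a ha)
      · rintro (h | h)
        · exact absurd ha (h a)
        · exact ⟨fun _ _ b => h b, fun b hb => absurd hb (h b)⟩
    · push Not at hS
      simp [hS]
  unfold indepPoly
  rw [sum_filter, ← Finset.sumEquiv.symm.toEquiv.sum_comp, Fintype.sum_prod_type]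
  have h2 : ∀ S : Finset α, S ≠ ∅ → ∀ T : Finset β, T ≠ ∅ → ¬ (S = ∅ ∨ T = ∅) := by tauto
  rw [← add_sum_erase _ _ (mem_univ (∅ : Finset α)), ← sum_pow_card_univ, ← sum_pow_card_univ,
    ← add_sum_erase univ (fun S : Finset α => x ^ #S) (mem_univ ∅), card_empty, pow_zero,
    add_sub_assoc, add_sub_cancel_left]
  congr 1
  · refine sum_congr rfl fun T _ => ?_
    exact (if_pos ((h (∅, T)).2 (Or.inl rfl))).trans (by simp)
  · refine sum_congr rfl fun S hS => ?_
    rw [sum_eq_single ∅]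
    · exact (if_pos ((h (S, ∅)).2 (Or.inr rfl))).trans (by simp)
    · intro T _ hT
      exact if_neg fun hh => h2 S (ne_of_mem_erase hS) T hT ((h (S, T)).1 hh)
    · simp

section Graph

variable {V : Type*} [Fintype V] (G : SimpleGraph V)

lemma bipPoly_const (x : ℝ) :
    bipPoly G.Adj (fun _ => x) (fun _ => x) =
      ∑ p : Finset V × Finset V with ∀ u ∈ p.1, ∀ v ∈ p.2, ¬ G.Adj u v, x ^ (#p.1 + #p.2) := by
  rw [sum_filter, Fintype.sum_prod_type, bipPoly]
  refine sum_congr rfl fun S _ => ?_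
  have h1 : ∏ b, (if ∀ a ∈ S, ¬ G.Adj a b then 1 + x else 1) =
      ∏ b with ∀ a ∈ S, ¬ G.Adj a b, (1 + x) := by rw [prod_filter]
  rw [prod_const, h1, prod_one_add, mul_sum]
  have h2 : ({b | ∀ a ∈ S, ¬ G.Adj a b} : Finset V).powerset =
      ({T | ∀ u ∈ S, ∀ v ∈ T, ¬ G.Adj u v} : Finset (Finset V)) := by
    ext T
    simp only [mem_powerset, subset_iff, mem_filter, mem_univ, true_and]
    exact ⟨fun h u hu v hv => h hv u hu, fun h v hv u hu => h u hu v hv⟩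
  rw [h2, sum_filter]
  refine sum_congr rfl fun T _ => ?_
  rw [prod_const, pow_add]

/-- A set `S` such that both `S` and `W \ S` are independent in `G`, if one exists. -/
noncomputable def bipartition (W : Finset V) : Finset V :=
  if h : ∃ S, (∀ u ∈ S, ∀ v ∈ S, ¬ G.Adj u v) ∧ ∀ u ∈ W \ S, ∀ v ∈ W \ S, ¬ G.Adj u v then
    h.choose else ∅

variable {G} in
lemma bipartition_spec {S T : Finset V} (hS : ∀ u ∈ S, ∀ v ∈ S, ¬ G.Adj u v)
    (hT : ∀ u ∈ T, ∀ v ∈ T, ¬ G.Adj u v) :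
    (∀ u ∈ bipartition G (S ∪ T), ∀ v ∈ bipartition G (S ∪ T), ¬ G.Adj u v) ∧
    ∀ u ∈ (S ∪ T) \ bipartition G (S ∪ T), ∀ v ∈ (S ∪ T) \ bipartition G (S ∪ T),
      ¬ G.Adj u v := by
  have h : ∃ S', (∀ u ∈ S', ∀ v ∈ S', ¬ G.Adj u v) ∧
      ∀ u ∈ (S ∪ T) \ S', ∀ v ∈ (S ∪ T) \ S', ¬ G.Adj u v :=
    ⟨S, hS, fun u hu v hv => hT u (by grind) v (by grind)⟩
  rw [bipartition, dif_pos h]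
  exact h.choose_spec

/-- Exchange the two sets of a pair on the set `C`. -/
def swapOn {α : Type*} [DecidableEq α] (C : Finset α) (p : Finset α × Finset α) :
    Finset α × Finset α :=
  ((p.1 \ C) ∪ (p.2 ∩ C), (p.2 \ C) ∪ (p.1 ∩ C))

lemma swapOn_swapOn {α : Type*} [DecidableEq α] (C : Finset α) (p : Finset α × Finset α) :
    swapOn C (swapOn C p) = p := by
  ext x <;> simp only [swapOn, mem_union, mem_sdiff, mem_inter] <;> tauto

lemma swapOn_union {α : Type*} [DecidableEq α] (C : Finset α) (p : Finset α × Finset α) :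
    (swapOn C p).1 ∪ (swapOn C p).2 = p.1 ∪ p.2 := by
  ext x
  simp only [swapOn, mem_union, mem_sdiff, mem_inter]
  tauto

lemma card_swapOn {α : Type*} [DecidableEq α] (C : Finset α) (p : Finset α × Finset α) :
    #(swapOn C p).1 + #(swapOn C p).2 = #p.1 + #p.2 := by
  have hd : ∀ S T : Finset α, Disjoint (S \ C) (T ∩ C) := fun S T =>
    disjoint_left.2 fun x hx hx' => (mem_sdiff.1 hx).2 (mem_inter.1 hx').2
  simp only [swapOn]
  rw [card_union_of_disjoint (hd _ _), card_union_of_disjoint (hd _ _)]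
  have h1 := card_sdiff_add_card_inter p.1 C
  have h2 := card_sdiff_add_card_inter p.2 C
  omega

/-- The bipartite swapping trick: comparison of `G` with its bipartite double cover. -/
lemma indepPoly_sq_le_bipPoly {x : ℝ} (hx : 0 ≤ x) :
    indepPoly G x ^ 2 ≤ bipPoly G.Adj (fun _ => x) (fun _ => x) := by
  rw [bipPoly_const, sq, indepPoly, sum_mul_sum, ← sum_product']
  set φ : Finset V × Finset V → Finset V × Finset V :=
    fun p => swapOn (bipartition G (p.1 ∪ p.2)) p with hφ
  have hinj : Function.Injective φ := by
    intro p q h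
    have hu : p.1 ∪ p.2 = q.1 ∪ q.2 := by
      rw [← swapOn_union (bipartition G (p.1 ∪ p.2)) p,
        ← swapOn_union (bipartition G (q.1 ∪ q.2)) q]
      exact congrArg (fun r => r.1 ∪ r.2) h
    rw [← swapOn_swapOn (bipartition G (p.1 ∪ p.2)) p]
    change swapOn _ (φ p) = q
    rw [h, hu]
    exact swapOn_swapOn _ q
  calc _ = ∑ p ∈ _, x ^ (#(φ p).1 + #(φ p).2) := sum_congr rfl fun p _ => by
        rw [← pow_add, hφ, card_swapOn]
    _ = _ := (sum_image (s := _) (f := fun q : Finset V × Finset V => x ^ (#q.1 + #q.2))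
        hinj.injOn).symm
    _ ≤ _ := sum_le_sum_of_subset_of_nonneg ?_ fun _ _ _ => by positivity
  intro q hq
  obtain ⟨⟨S, T⟩, hp, rfl⟩ := mem_image.1 hq
  simp only [mem_product, mem_filter, mem_univ, true_and] at hp
  obtain ⟨hS, hT⟩ := hp
  obtain ⟨hC, hD⟩ := bipartition_spec hS hT
  simp only [mem_filter, mem_univ, true_and, hφ, swapOn]
  generalize bipartition G (S ∪ T) = C at *
  intro u hu v hv
  simp only [mem_union, mem_sdiff, mem_inter] at hu hv hD
  rcases hu with hu | hu <;> rcases hv with hv | hv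
  · exact hD u ⟨Or.inl hu.1, hu.2⟩ v ⟨Or.inr hv.1, hv.2⟩
  · exact hS u hu.1 v hv.1
  · exact hT u hu.1 v hv.1
  · exact hC u hu.2 v hv.2

lemma prod_prod_neighborFinset_eq_sq (F : Sym2 V → ℝ) :
    ∏ v, ∏ u with G.Adj v u, F s(v, u) = (∏ e ∈ G.edgeFinset, F e) ^ 2 := by
  have h1 : ∏ d : G.Dart, F d.edge = (∏ e ∈ G.edgeFinset, F e) ^ 2 := by
    rw [← prod_pow, ← prod_fiberwise_of_maps_to (s := univ) (t := G.edgeFinset)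
      (g := fun d : G.Dart => d.edge) (fun d _ => by simp)]
    refine prod_congr rfl fun e he => ?_
    rw [prod_congr rfl fun d hd => congrArg F (mem_filter.1 hd).2, prod_const,
      G.dart_edge_fiber_card e (by simpa using he)]
  rw [← h1, ← prod_finset_product' (univ.filter fun p : V × V => G.Adj p.1 p.2) univ
    (fun v => univ.filter (G.Adj v)) (by simp)]
  symm
  refine prod_bij (fun d _ => d.toProd) (by simp) (fun d _ d' _ h => SimpleGraph.Dart.ext _ _ h)
    (fun p hp => ⟨⟨p, (mem_filter.1 hp).2⟩, mem_univ _, rfl⟩) fun d _ => rfl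

end Graph

/-- **Sah–Sawhney–Stoner–Zhao (weighted version).** If `G` has no isolated vertices
and `λ > 0`, then `P_G(λ) ≤ ∏_{uv ∈ E(G)} P_{K_{d_u,d_v}}(λ)^{1/(d_u d_v)}`. -/
theorem indepPoly_upper_bound {V : Type*} [Fintype V] (G : SimpleGraph V)
    (hiso : ∀ v : V, 0 < G.degree v) (lam : ℝ) (hlam : 0 < lam) :
    indepPoly G lam ≤ ∏ e ∈ G.edgeFinset, edgeWeightP G lam e := by
  have hdeg : ∀ v, #{u | G.Adj v u} = G.degree v := fun v => by
    rw [← G.card_neighborFinset_eq_degree, G.neighborFinset_eq_filter]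
  have hdeg' : ∀ v, #{u | G.Adj u v} = G.degree v := fun v => by
    simp only [← hdeg, G.adj_comm v]
  have hw : ∀ u v, edgeWeightP G lam s(u, v) =
      bipWeight (G.degree u) (G.degree v) lam lam := by
    intro u v
    simp [edgeWeightP, bipWeight, indepPoly_completeBipartiteGraph]
  have h := (indepPoly_sq_le_bipPoly G hlam.le).trans
    (bipPoly_le G.Adj _ _ (fun _ => hlam.le) fun _ => hlam.le)
  simp only [vertexBound, hdeg, hdeg', (hiso _).ne', if_false, one_mul, prod_const_one, mul_one,
    ← hw] at h
  rw [prod_prod_neighborFinset_eq_sq] at h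
  refine le_of_sq_le_sq h (prod_nonneg fun e _ => ?_)
  induction e with
  | _ u v => exact hw u v ▸ (bipWeight_pos _ _ hlam.le hlam.le).le
end

section
/- Let d ≥ 1 and let G be a d-regular bipartite finite simple graph on n vertices. Then the number of independent sets of G satisfies i(G) ≤ (2^{d+1} − 1)^{n/(2d)}. -/
open Finset
open scoped Classical

/-- The two-point case of Hölder's inequality for `d` functions with equal exponents `d`. -/
theorem prod_rpow_add_prod_rpow_le {ι : Type*} (s : Finset ι) (hs : s.Nonempty) (x y : ι → ℝ)
    (hx : ∀ i, 0 ≤ x i) (hy : ∀ i, 0 ≤ y i) :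
    ∏ i ∈ s, x i ^ (1 / (s.card : ℝ)) + ∏ i ∈ s, y i ^ (1 / (s.card : ℝ)) ≤
      ∏ i ∈ s, (x i + y i) ^ (1 / (s.card : ℝ)) := by
  have hc : (0 : ℝ) < s.card := by exact_mod_cast hs.card_pos
  by_cases h0 : ∃ i ∈ s, x i + y i = 0
  · obtain ⟨i, hi, h⟩ := h0
    have hxi : x i = 0 := by linarith [hx i, hy i]
    have hyi : y i = 0 := by linarith [hx i, hy i]
    have hp : (1 / (s.card : ℝ)) ≠ 0 := by positivity
    rw [Finset.prod_eq_zero hi (by rw [hxi, Real.zero_rpow hp]),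
      Finset.prod_eq_zero hi (by rw [hyi, Real.zero_rpow hp]), add_zero]
    exact Finset.prod_nonneg fun j _ => Real.rpow_nonneg (add_nonneg (hx j) (hy j)) _
  · push Not at h0
    have hpos : ∀ i ∈ s, 0 < x i + y i := fun i hi =>
      lt_of_le_of_ne (add_nonneg (hx i) (hy i)) (h0 i hi).symm
    have hw : ∑ _i ∈ s, 1 / (s.card : ℝ) = 1 := by
      rw [Finset.sum_const, nsmul_eq_mul]; field_simp
    have amgm (z : ι → ℝ) (hz : ∀ i, 0 ≤ z i) :
        ∏ i ∈ s, z i ^ (1 / (s.card : ℝ)) ≤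
          (∑ i ∈ s, 1 / (s.card : ℝ) * (z i / (x i + y i))) *
            ∏ i ∈ s, (x i + y i) ^ (1 / (s.card : ℝ)) := by
      have h := Real.geom_mean_le_arith_mean_weighted s (fun _ => 1 / (s.card : ℝ))
        (fun i => z i / (x i + y i)) (fun _ _ => by positivity) hw
        (fun i hi => div_nonneg (hz i) (hpos i hi).le)
      refine le_trans (le_of_eq ?_) (mul_le_mul_of_nonneg_right h
        (Finset.prod_nonneg fun i hi => Real.rpow_nonneg (hpos i hi).le _))
      rw [← Finset.prod_mul_distrib]
      refine Finset.prod_congr rfl fun i hi => ?_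
      rw [← Real.mul_rpow (div_nonneg (hz i) (hpos i hi).le) (hpos i hi).le,
        div_mul_cancel₀ _ (h0 i hi)]
    refine (add_le_add (amgm x hx) (amgm y hy)).trans (le_of_eq ?_)
    rw [← add_mul, ← Finset.sum_add_distrib]
    have : ∑ i ∈ s, (1 / (s.card : ℝ) * (x i / (x i + y i)) +
        1 / (s.card : ℝ) * (y i / (x i + y i))) = 1 := by
      refine Eq.trans ?_ hw
      refine Finset.sum_congr rfl fun i hi => ?_
      rw [← mul_add, ← add_div, div_self (h0 i hi), mul_one]
    rw [this, one_mul]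

/-- Finner's generalized Hölder inequality on the discrete cube: every element of `A` lies in
exactly `d` of the sets `N b`, and the `b`-th function only depends on `S ∩ N b`. -/
theorem sum_powerset_prod_rpow_le {V ι : Type*} (B : Finset ι) (N : ι → Finset V) {d : ℕ}
    (hd : 1 ≤ d) (A : Finset V) (hA : ∀ a ∈ A, (B.filter fun b => a ∈ N b).card = d)
    (f : ι → Finset V → ℝ) (hf : ∀ b T, 0 ≤ f b T) :
    ∑ S ∈ A.powerset, ∏ b ∈ B, f b (S ∩ N b) ^ (1 / (d : ℝ)) ≤
      ∏ b ∈ B, (∑ T ∈ (A ∩ N b).powerset, f b T) ^ (1 / (d : ℝ)) := by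
  induction A using Finset.induction_on generalizing f with
  | empty => simp
  | insert a A ha ih =>
    let g : ι → Finset V → ℝ := fun b T => if a ∈ N b then f b T + f b (insert a T) else f b T
    have hg : ∀ b T, 0 ≤ g b T := fun b T => by
      dsimp only [g]
      split_ifs
      exacts [add_nonneg (hf _ _) (hf _ _), hf _ _]
    have hcard := hA a (mem_insert_self a A)
    have hne : (B.filter fun b => a ∈ N b).Nonempty := card_pos.1 (by omega)
    rw [sum_powerset_insert ha, ← sum_add_distrib]
    calc _ ≤ ∑ S ∈ A.powerset, ∏ b ∈ B, g b (S ∩ N b) ^ (1 / (d : ℝ)) := by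
          refine sum_le_sum fun S _ => ?_
          simp only [← prod_filter_mul_prod_filter_not B (fun b => a ∈ N b)]
          have h₁ : ∏ b ∈ B with a ∉ N b, f b (insert a S ∩ N b) ^ (1 / (d : ℝ)) =
              ∏ b ∈ B with a ∉ N b, f b (S ∩ N b) ^ (1 / (d : ℝ)) :=
            prod_congr rfl fun b hb => by rw [insert_inter_of_notMem (mem_filter.1 hb).2]
          have h₂ : ∏ b ∈ B with a ∈ N b, f b (insert a S ∩ N b) ^ (1 / (d : ℝ)) =
              ∏ b ∈ B with a ∈ N b, f b (insert a (S ∩ N b)) ^ (1 / (d : ℝ)) :=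
            prod_congr rfl fun b hb => by rw [insert_inter_of_mem (mem_filter.1 hb).2]
          have h₃ : ∏ b ∈ B with a ∉ N b, g b (S ∩ N b) ^ (1 / (d : ℝ)) =
              ∏ b ∈ B with a ∉ N b, f b (S ∩ N b) ^ (1 / (d : ℝ)) :=
            prod_congr rfl fun b hb => by simp only [g, if_neg (mem_filter.1 hb).2]
          have h₄ : ∏ b ∈ B with a ∈ N b, g b (S ∩ N b) ^ (1 / (d : ℝ)) =
              ∏ b ∈ B with a ∈ N b,
                (f b (S ∩ N b) + f b (insert a (S ∩ N b))) ^ (1 / (d : ℝ)) :=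
            prod_congr rfl fun b hb => by simp only [g, if_pos (mem_filter.1 hb).2]
          rw [h₁, h₂, h₃, h₄, ← add_mul]
          refine mul_le_mul_of_nonneg_right ?_
            (prod_nonneg fun b _ => Real.rpow_nonneg (hf _ _) _)
          have := prod_rpow_add_prod_rpow_le _ hne (fun b => f b (S ∩ N b))
            (fun b => f b (insert a (S ∩ N b))) (fun _ => hf _ _) (fun _ => hf _ _)
          rwa [hcard] at this
      _ ≤ ∏ b ∈ B, (∑ T ∈ (A ∩ N b).powerset, g b T) ^ (1 / (d : ℝ)) :=
          ih (fun x hx => hA x (mem_insert_of_mem hx)) g hg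
      _ = _ := by
          refine prod_congr rfl fun b _ => ?_
          congr 1
          by_cases hb : a ∈ N b
          · rw [insert_inter_of_mem hb, sum_powerset_insert (by simp [ha]), ← sum_add_distrib]
            simp only [g, if_pos hb]
          · rw [insert_inter_of_notMem hb]
            simp only [g, if_neg hb]

/-- In a graph with bipartition `(A, Aᶜ)`, an independent set consists of some `S ⊆ A` together
with a set of vertices of `Aᶜ` having no neighbour in `S`. -/
theorem numIndepSets_le_sum_powerset {V : Type*} [Fintype V] (G : SimpleGraph V) (A : Finset V) :
    numIndepSets G ≤
      ∑ S ∈ A.powerset, ∏ b ∈ Aᶜ, if S ∩ G.neighborFinset b = ∅ then 2 else 1 := by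
  unfold numIndepSets
  rw [card_eq_sum_card_fiberwise (f := fun S => S ∩ A) (t := A.powerset)
    (fun S _ => mem_coe.2 (mem_powerset.2 inter_subset_right))]
  refine sum_le_sum fun S _ => ?_
  rw [← prod_filter, prod_const, ← card_powerset]
  refine card_le_card_of_injOn (fun T => T ∩ Aᶜ) ?_ ?_
  · intro T hT
    simp only [coe_filter, Set.mem_ofPred_eq, mem_filter, mem_univ, true_and] at hT
    obtain ⟨hT, rfl⟩ := hT
    simp only [coe_powerset, Set.mem_preimage, Set.mem_powerset_iff, coe_subset]
    intro b hb
    rw [mem_inter] at hb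
    refine mem_filter.2 ⟨hb.2, eq_empty_of_forall_notMem fun v hv => ?_⟩
    simp only [mem_inter, SimpleGraph.mem_neighborFinset] at hv
    exact hT b hb.1 v hv.1.1 hv.2
  · intro T hT T' hT' h
    simp only [coe_filter, Set.mem_ofPred_eq] at hT hT'
    have hA : T ∩ A = T' ∩ A := hT.2.trans hT'.2.symm
    ext v
    have h₁ := Finset.ext_iff.1 hA v
    have h₂ := Finset.ext_iff.1 h v
    simp only [mem_inter, mem_compl] at h₁ h₂
    tauto

theorem sum_powerset_ite_eq_empty {V : Type*} (N : Finset V) :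
    ∑ T ∈ N.powerset, (if T = ∅ then (2 : ℝ) ^ N.card else 1) = 2 ^ (N.card + 1) - 1 := by
  have : ∀ T : Finset V, (if T = ∅ then (2 : ℝ) ^ N.card else 1) =
      1 + if T = ∅ then (2 : ℝ) ^ N.card - 1 else 0 := fun T => by split_ifs <;> ring
  simp only [this, sum_add_distrib, sum_ite_eq', sum_const, card_powerset, nsmul_eq_mul,
    empty_mem_powerset, if_true]
  push_cast
  ring

/-- **Kahn.** If `G` is a `d`-regular bipartite graph on `n` vertices (`d ≥ 1`), then
`i(G) ≤ (2^{d+1} - 1)^{n/(2d)}`. -/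
theorem kahn_bipartite_regular {V : Type*} [Fintype V] (G : SimpleGraph V) (d n : ℕ)
    (hd : 1 ≤ d) (hn : Fintype.card V = n) (hreg : G.IsRegularOfDegree d)
    (hbip : G.Colorable 2) :
    (numIndepSets G : ℝ) ≤ ((2:ℝ) ^ (d + 1) - 1) ^ ((n : ℝ) / (2 * d)) := by
  obtain ⟨c⟩ := hbip
  let A : Finset V := univ.filter fun v => c v = 0
  have hadj : ∀ u v, G.Adj u v → (u ∈ A ↔ v ∉ A) := fun u v huv => by
    have := c.valid huv
    simp only [A, mem_filter, mem_univ, true_and]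
    omega
  have hdeg : ∀ v, (G.neighborFinset v).card = d := fun v => hreg.degree_eq v
  have hfilter : ∀ a ∈ A, (Aᶜ.filter fun b => a ∈ G.neighborFinset b).card = d := fun a ha => by
    rw [← hdeg a]
    congr 1
    ext b
    simp only [mem_filter, mem_compl, SimpleGraph.mem_neighborFinset]
    exact ⟨fun h => h.2.symm, fun h => ⟨(hadj a b h).1 ha, h.symm⟩⟩
  have hinter : ∀ b ∈ Aᶜ, A ∩ G.neighborFinset b = G.neighborFinset b := fun b hb => by
    refine inter_eq_right.2 fun v hv => ?_
    have := hadj b v ((G.mem_neighborFinset b v).1 hv)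
    rw [mem_compl] at hb
    tauto
  have hhalf : A.card = Aᶜ.card := by
    have h := sum_card_bipartiteAbove_eq_sum_card_bipartiteBelow (s := A) (t := Aᶜ)
      (fun a b => a ∈ G.neighborFinset b)
    unfold bipartiteAbove bipartiteBelow at h
    rw [sum_congr rfl hfilter, sum_congr rfl (fun b hb => (congrArg card
      (filter_mem_eq_inter.trans (hinter b hb))).trans (hdeg b))] at h
    simp only [sum_const, smul_eq_mul] at h
    exact Nat.eq_of_mul_eq_mul_right hd h
  have hcard : (n : ℝ) = 2 * Aᶜ.card := by
    rw [← hn, ← card_add_card_compl A, hhalf]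
    push_cast
    ring
  have hd0 : (d : ℝ) ≠ 0 := by positivity
  have hpow : ∀ T : Finset V, (if T = ∅ then (2 : ℝ) ^ d else 1) ^ (1 / (d : ℝ)) =
      if T = ∅ then 2 else 1 := fun T => by
    split_ifs
    · rw [one_div, Real.pow_rpow_inv_natCast zero_le_two (by omega)]
    · exact Real.one_rpow _
  calc (numIndepSets G : ℝ)
      ≤ ∑ S ∈ A.powerset, ∏ b ∈ Aᶜ, if S ∩ G.neighborFinset b = ∅ then (2 : ℝ) else 1 := by
        exact_mod_cast numIndepSets_le_sum_powerset G A
    _ ≤ ∏ b ∈ Aᶜ, (∑ T ∈ (A ∩ G.neighborFinset b).powerset,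
          if T = ∅ then (2 : ℝ) ^ d else 1) ^ (1 / (d : ℝ)) := by
        simp only [← hpow]
        exact sum_powerset_prod_rpow_le Aᶜ (fun b => G.neighborFinset b) hd A hfilter
          (fun _ T => if T = ∅ then (2 : ℝ) ^ d else 1) fun _ T => by positivity
    _ = ∏ _b ∈ Aᶜ, ((2 : ℝ) ^ (d + 1) - 1) ^ (1 / (d : ℝ)) := by
        refine prod_congr rfl fun b hb => ?_
        rw [hinter b hb, ← hdeg b, sum_powerset_ite_eq_empty]
    _ = ((2 : ℝ) ^ (d + 1) - 1) ^ ((n : ℝ) / (2 * d)) := by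
        have h1 : (1 : ℝ) ≤ 2 ^ (d + 1) := one_le_pow₀ one_le_two
        rw [prod_const, ← Real.rpow_mul_natCast (by linarith), hcard]
        congr 1
        field_simp
end

section
/- Let d ≥ 1 and let G be a d-regular finite simple graph on n vertices. Then the number of independent sets of G satisfies i(G) ≤ (2^{d+1} − 1)^{n/(2d)}. Moreover, equality holds if and only if G is a disjoint union of copies of the complete bipartite graph K_{d,d}. -/
open Finset
open scoped Classical

/-- `G` is a disjoint union of copies of `K_{d,d}`: every connected component of `G`
(as an induced subgraph) is isomorphic to the complete bipartite graph `K_{d,d}`. -/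
def IsDisjUnionKdd {V : Type*} (G : SimpleGraph V) (d : ℕ) : Prop :=
  ∀ C : G.ConnectedComponent,
    Nonempty
      ((G.induce {v | G.connectedComponentMk v = C}) ≃g completeBipartiteGraph (Fin d) (Fin d))

section Finner

variable {α ι : Type*}

/-- The two-point case of Hölder's inequality for `d` positive functions. -/
theorem prod_rpow_add_prod_rpow_le_s3 {s : Finset ι} {d : ℕ} (hd : d ≠ 0) (hs : #s = d)
    {a b : ι → ℝ} (ha : ∀ i, 0 < a i) (hb : ∀ i, 0 < b i) :
    ∏ i ∈ s, a i ^ (d : ℝ)⁻¹ + ∏ i ∈ s, b i ^ (d : ℝ)⁻¹ ≤ ∏ i ∈ s, (a i + b i) ^ (d : ℝ)⁻¹ ∧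
      ((∃ j ∈ s, ∃ k ∈ s, a j * b k ≠ a k * b j) →
        ∏ i ∈ s, a i ^ (d : ℝ)⁻¹ + ∏ i ∈ s, b i ^ (d : ℝ)⁻¹ <
          ∏ i ∈ s, (a i + b i) ^ (d : ℝ)⁻¹) := by
  have hab : ∀ i, 0 < a i + b i := fun i => add_pos (ha i) (hb i)
  have hP : 0 < ∏ i ∈ s, (a i + b i) ^ (d : ℝ)⁻¹ :=
    prod_pos fun i _ => Real.rpow_pos_of_pos (hab i) _
  have hw : ∑ _i ∈ s, (d : ℝ)⁻¹ = 1 := by simp [hs, hd]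
  have hw0 : ∀ i ∈ s, (0 : ℝ) < (d : ℝ)⁻¹ := fun _ _ => by positivity
  have hsplit : ∀ c : ι → ℝ, (∀ i, 0 < c i) → ∏ i ∈ s, c i ^ (d : ℝ)⁻¹ =
      (∏ i ∈ s, (c i / (a i + b i)) ^ (d : ℝ)⁻¹) * ∏ i ∈ s, (a i + b i) ^ (d : ℝ)⁻¹ := by
    intro c hc
    rw [← prod_mul_distrib]
    refine prod_congr rfl fun i _ => ?_
    rw [← Real.mul_rpow (div_pos (hc i) (hab i)).le (hab i).le, div_mul_cancel₀ _ (hab i).ne']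
  have hza : ∀ i ∈ s, 0 ≤ a i / (a i + b i) := fun i _ => (div_pos (ha i) (hab i)).le
  have hzb : ∀ i ∈ s, 0 ≤ b i / (a i + b i) := fun i _ => (div_pos (hb i) (hab i)).le
  have hsum : ∑ i ∈ s, (d : ℝ)⁻¹ * (a i / (a i + b i)) +
      ∑ i ∈ s, (d : ℝ)⁻¹ * (b i / (a i + b i)) = 1 := by
    rw [← sum_add_distrib, ← hw]
    refine sum_congr rfl fun i _ => ?_
    rw [← mul_add, ← add_div, div_self (hab i).ne', mul_one]
  have hA := Real.geom_mean_le_arith_mean_weighted s _ _ (fun i hi => (hw0 i hi).le) hw hza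
  have hB := Real.geom_mean_le_arith_mean_weighted s _ _ (fun i hi => (hw0 i hi).le) hw hzb
  rw [hsplit a ha, hsplit b hb, ← add_mul]
  refine ⟨mul_le_of_le_one_left hP.le (by linarith), ?_⟩
  rintro ⟨j, hj, k, hk, hjk⟩
  have hlt := (Real.geom_mean_lt_arith_mean_weighted_iff_of_pos s _ _ hw0 hw hza).2
    ⟨j, hj, k, hk, fun h => hjk (by
      rw [div_eq_div_iff (hab j).ne' (hab k).ne'] at h
      linarith)⟩
  exact mul_lt_of_lt_one_left hP (by linarith)

/-- Sum out the coordinate `u` from those functions `φ j` that depend on it. -/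
noncomputable def sumOut (E : ι → Finset α) (φ : ι → Finset α → ℝ) (u : α) (j : ι)
    (A : Finset α) : ℝ :=
  if u ∈ E j then φ j A + φ j (insert u A) else φ j A

variable {E : ι → Finset α} {φ : ι → Finset α → ℝ} {u : α}

theorem sumOut_pos (hφ : ∀ j A, 0 < φ j A) (j : ι) (A : Finset α) : 0 < sumOut E φ u j A := by
  unfold sumOut
  split_ifs
  · exact add_pos (hφ _ _) (hφ _ _)
  · exact hφ _ _

theorem sumOut_inter (hE : ∀ j A, φ j (A ∩ E j) = φ j A) (j : ι) (A : Finset α) :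
    sumOut E φ u j (A ∩ E j) = sumOut E φ u j A := by
  unfold sumOut
  split_ifs with hu
  · rw [hE, ← hE j (insert u A), insert_inter_of_mem hu]
  · exact hE _ _

theorem sum_powerset_sumOut {s : Finset α} (hu : u ∉ s) (j : ι) :
    ∑ A ∈ (s ∩ E j).powerset, sumOut E φ u j A =
      ∑ A ∈ (insert u s ∩ E j).powerset, φ j A := by
  unfold sumOut
  split_ifs with huj
  · rw [insert_inter_of_mem huj, sum_powerset_insert (by simp [hu]), sum_add_distrib]
  · rw [insert_inter_of_notMem huj]

variable [Fintype ι] {d : ℕ}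

/-- Apply Hölder's inequality in a single coordinate. -/
theorem sum_powerset_insert_prod_rpow_le (hd : d ≠ 0) (hdeg : #{j | u ∈ E j} = d)
    (hφ : ∀ j A, 0 < φ j A) (hE : ∀ j A, φ j (A ∩ E j) = φ j A) {s : Finset α} (hu : u ∉ s) :
    ∑ A ∈ (insert u s).powerset, ∏ j, φ j A ^ (d : ℝ)⁻¹ ≤
        ∑ A ∈ s.powerset, ∏ j, sumOut E φ u j A ^ (d : ℝ)⁻¹ ∧
      ((∃ A ⊆ s, ∃ j k, u ∈ E j ∧ u ∈ E k ∧
          φ j A * φ k (insert u A) ≠ φ k A * φ j (insert u A)) →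
        ∑ A ∈ (insert u s).powerset, ∏ j, φ j A ^ (d : ℝ)⁻¹ <
          ∑ A ∈ s.powerset, ∏ j, sumOut E φ u j A ^ (d : ℝ)⁻¹) := by
  have hins : ∀ j A, u ∉ E j → φ j (insert u A) = φ j A := fun j A hj => by
    rw [← hE j (insert u A), insert_inter_of_notMem hj, hE]
  have hpos : ∀ A, 0 < ∏ j with u ∉ E j, φ j A ^ (d : ℝ)⁻¹ := fun A =>
    prod_pos fun j _ => Real.rpow_pos_of_pos (hφ j A) _
  have hL : ∀ A, ∏ j, φ j A ^ (d : ℝ)⁻¹ + ∏ j, φ j (insert u A) ^ (d : ℝ)⁻¹ =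
      (∏ j with u ∈ E j, φ j A ^ (d : ℝ)⁻¹ +
        ∏ j with u ∈ E j, φ j (insert u A) ^ (d : ℝ)⁻¹) *
          ∏ j with u ∉ E j, φ j A ^ (d : ℝ)⁻¹ := by
    intro A
    rw [add_mul, prod_filter_mul_prod_filter_not,
      ← prod_filter_mul_prod_filter_not univ (fun j => u ∈ E j)
        (fun j => φ j (insert u A) ^ (d : ℝ)⁻¹)]
    congr 2
    refine prod_congr rfl fun j hj => ?_
    rw [hins j A (by simpa using hj)]
  have hR : ∀ A, ∏ j, sumOut E φ u j A ^ (d : ℝ)⁻¹ =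
      (∏ j with u ∈ E j, (φ j A + φ j (insert u A)) ^ (d : ℝ)⁻¹) *
          ∏ j with u ∉ E j, φ j A ^ (d : ℝ)⁻¹ := by
    intro A
    rw [← prod_filter_mul_prod_filter_not univ (fun j => u ∈ E j)]
    congr 1 <;> refine prod_congr rfl fun j hj => ?_ <;> simp_all [sumOut]
  have key := fun A => prod_rpow_add_prod_rpow_le_s3 hd hdeg (a := fun j => φ j A)
    (b := fun j => φ j (insert u A)) (fun j => hφ j A) (fun j => hφ j _)
  rw [sum_powerset_insert hu, ← sum_add_distrib]
  have hle : ∀ A, ∏ j, φ j A ^ (d : ℝ)⁻¹ + ∏ j, φ j (insert u A) ^ (d : ℝ)⁻¹ ≤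
      ∏ j, sumOut E φ u j A ^ (d : ℝ)⁻¹ := fun A => by
    rw [hL, hR]
    exact mul_le_mul_of_nonneg_right (key A).1 (hpos A).le
  refine ⟨sum_le_sum fun A _ => hle A, ?_⟩
  rintro ⟨A, hA, j, k, hj, hk, hjk⟩
  refine sum_lt_sum (fun A _ => hle A) ⟨A, mem_powerset.2 hA, ?_⟩
  rw [hL, hR]
  exact mul_lt_mul_of_pos_right
    ((key A).2 ⟨j, by simpa using hj, k, by simpa using hk, hjk⟩) (hpos A)

/-- **Finner's inequality** on a discrete cube, for a family `E` covering every coordinate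
exactly `d` times. -/
theorem sum_powerset_prod_rpow_le_s3 (hd : d ≠ 0) (hdeg : ∀ u, #{j | u ∈ E j} = d)
    (s : Finset α) : ∀ {φ : ι → Finset α → ℝ}, (∀ j A, 0 < φ j A) →
      (∀ j A, φ j (A ∩ E j) = φ j A) →
    ∑ A ∈ s.powerset, ∏ j, φ j A ^ (d : ℝ)⁻¹ ≤
      ∏ j, (∑ A ∈ (s ∩ E j).powerset, φ j A) ^ (d : ℝ)⁻¹ := by
  induction s using Finset.induction_on with
  | empty => intro φ _ _; simp
  | insert u s hu ih =>
    intro φ hφ hE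
    refine (sum_powerset_insert_prod_rpow_le hd (hdeg u) hφ hE hu).1.trans ?_
    refine (ih (sumOut_pos hφ) (sumOut_inter hE)).trans_eq ?_
    simp_rw [sum_powerset_sumOut hu]

/-- A strict form of Finner's inequality: Hölder's inequality is strict in the coordinate `u`. -/
theorem sum_prod_rpow_lt [Fintype α] (hd : d ≠ 0) (hdeg : ∀ u, #{j | u ∈ E j} = d)
    (hφ : ∀ j A, 0 < φ j A) (hE : ∀ j A, φ j (A ∩ E j) = φ j A) {A : Finset α} (hu : u ∉ A)
    {j k : ι} (hj : u ∈ E j) (hk : u ∈ E k)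
    (hjk : φ j A * φ k (insert u A) ≠ φ k A * φ j (insert u A)) :
    ∑ A, ∏ j, φ j A ^ (d : ℝ)⁻¹ < ∏ j, (∑ A ∈ (E j).powerset, φ j A) ^ (d : ℝ)⁻¹ := by
  have hlt := (sum_powerset_insert_prod_rpow_le hd (hdeg u) hφ hE (notMem_erase u univ)).2
    ⟨A, fun x hx => by simpa using ne_of_mem_of_not_mem hx hu, j, k, hj, hk, hjk⟩
  have hle := sum_powerset_prod_rpow_le_s3 hd hdeg (univ.erase u)
    (sumOut_pos (E := E) (u := u) hφ) (sumOut_inter hE)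
  simp_rw [sum_powerset_sumOut (notMem_erase u univ)] at hle
  simpa using hlt.trans_le hle

end Finner

section IndependentSets

variable {V : Type*} [Fintype V] (G : SimpleGraph V)

/-- **Zhao's swapping trick**: pairs of independent sets inject into pairs of sets with no edges
between them. -/
theorem numIndepSets_sq_le_s3 :
    numIndepSets G ^ 2 ≤
      #{p : Finset V × Finset V | ∀ u ∈ p.1, ∀ v ∈ p.2, ¬ G.Adj u v} := by
  obtain ⟨c, hc⟩ : ∃ c : Finset V → Finset V, ∀ A B : Finset V,
      (∀ u ∈ A, ∀ v ∈ A, ¬ G.Adj u v) → (∀ u ∈ B, ∀ v ∈ B, ¬ G.Adj u v) →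
      ∀ u ∈ A ∪ B, ∀ v ∈ A ∪ B, G.Adj u v → (u ∈ c (A ∪ B) ↔ v ∉ c (A ∪ B)) := by
    have h : ∀ W : Finset V, ∃ T : Finset V,
        (∃ T : Finset V, ∀ u ∈ W, ∀ v ∈ W, G.Adj u v → (u ∈ T ↔ v ∉ T)) →
        ∀ u ∈ W, ∀ v ∈ W, G.Adj u v → (u ∈ T ↔ v ∉ T) := fun W => by
      by_cases hW : ∃ T : Finset V, ∀ u ∈ W, ∀ v ∈ W, G.Adj u v → (u ∈ T ↔ v ∉ T)
      · exact hW.imp fun T hT _ => hT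
      · exact ⟨∅, fun h => absurd h hW⟩
    choose c hc using h
    refine ⟨c, fun A B hA hB => hc _ ⟨A, fun u hu v hv huv => ?_⟩⟩
    have h1 := hA u
    have h2 := hB u
    grind
  rw [numIndepSets, sq, ← card_product]
  refine card_le_card_of_injOn
    (fun p => ((p.1 \ c (p.1 ∪ p.2)) ∪ (p.2 ∩ c (p.1 ∪ p.2)),
      (p.2 \ c (p.1 ∪ p.2)) ∪ (p.1 ∩ c (p.1 ∪ p.2)))) ?_ ?_
  · rintro ⟨A, B⟩ hp
    simp only [coe_product, coe_filter, Set.mem_prod, Set.mem_ofPred_eq, mem_univ, true_and] at hp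
    have hs := hc A B hp.1 hp.2
    simp only [coe_filter, Set.mem_ofPred_eq, mem_univ, true_and]
    intro u hu v hv huv
    have := hs u (by grind) v (by grind) huv
    have h1 := hp.1 u
    have h2 := hp.2 u
    grind
  · rintro ⟨A, B⟩ _ ⟨A', B'⟩ _ h
    simp only [Prod.mk.injEq] at h
    obtain ⟨h1, h2⟩ := h
    have hunion : ∀ X Y T : Finset V, (X \ T ∪ Y ∩ T) ∪ (Y \ T ∪ X ∩ T) = X ∪ Y := by
      intro X Y T
      ext x
      simp only [mem_union, mem_sdiff, mem_inter]
      tauto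
    have hU : A ∪ B = A' ∪ B' := by rw [← hunion A B (c (A ∪ B)), h1, h2, hunion]
    rw [hU] at h1 h2
    generalize c (A' ∪ B') = T at h1 h2
    have h : ∀ x, (x ∈ A ↔ x ∈ A') ∧ (x ∈ B ↔ x ∈ B') := by
      intro x
      replace h1 := Finset.ext_iff.1 h1 x
      replace h2 := Finset.ext_iff.1 h2 x
      by_cases hT : x ∈ T <;> simp [hT] at h1 h2
      · exact ⟨h2, h1⟩
      · exact ⟨h1, h2⟩
    exact Prod.ext (Finset.ext fun x => (h x).1) (Finset.ext fun x => (h x).2)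

/-- The neighbourhood of a vertex, as a finset. -/
noncomputable def nbhd (v : V) : Finset V := {u | G.Adj v u}

variable {G}

theorem mem_nbhd {u v : V} : u ∈ nbhd G v ↔ G.Adj v u := by simp [nbhd]

variable {d : ℕ}

theorem card_nbhd (hreg : G.IsRegularOfDegree d) (v : V) : #(nbhd G v) = d := by
  rw [← hreg v, ← G.card_neighborFinset_eq_degree]
  congr 1
  ext u
  simp [nbhd]

theorem card_filter_mem_nbhd (hreg : G.IsRegularOfDegree d) (u : V) :
    #{v | u ∈ nbhd G v} = d := by
  rw [← card_nbhd hreg u]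
  congr 1
  ext v
  simp [nbhd, G.adj_comm]

/-- The `d`-th power of the number of choices for `v ∈ B`, given the set `A`, in a pair `(A, B)`
with no edges between `A` and `B`. -/
noncomputable def choiceWeight (G : SimpleGraph V) (d : ℕ) (v : V) (A : Finset V) : ℝ :=
  if Disjoint A (nbhd G v) then 2 ^ d else 1

theorem choiceWeight_pos (v : V) (A : Finset V) : 0 < choiceWeight G d v A := by
  unfold choiceWeight
  split_ifs <;> positivity

theorem choiceWeight_inter (v : V) (A : Finset V) :
    choiceWeight G d v (A ∩ nbhd G v) = choiceWeight G d v A := by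
  simp [choiceWeight, disjoint_iff_inter_eq_empty]

theorem sum_choiceWeight (hreg : G.IsRegularOfDegree d) (v : V) :
    ∑ A ∈ (nbhd G v).powerset, choiceWeight G d v A = 2 ^ (d + 1) - 1 := by
  have h : ∀ A ∈ (nbhd G v).powerset,
      choiceWeight G d v A = (if A = ∅ then (2 ^ d - 1 : ℝ) else 0) + 1 := by
    intro A hA
    have : Disjoint A (nbhd G v) ↔ A = ∅ := by
      rw [disjoint_iff_inter_eq_empty, inter_eq_left.2 (mem_powerset.1 hA)]
    simp only [choiceWeight, this]
    split_ifs <;> ring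
  rw [sum_congr rfl h, sum_add_distrib, sum_ite_eq' _ _ fun _ => (2 ^ d - 1 : ℝ)]
  simp [card_nbhd hreg]
  ring

theorem card_pairs_eq_sum (hd : d ≠ 0) :
    (#{p : Finset V × Finset V | ∀ u ∈ p.1, ∀ v ∈ p.2, ¬ G.Adj u v} : ℝ) =
      ∑ A : Finset V, ∏ v, choiceWeight G d v A ^ (d : ℝ)⁻¹ := by
  have h : ∀ A : Finset V, ∏ v, choiceWeight G d v A ^ (d : ℝ)⁻¹ =
      #(powerset {v | Disjoint A (nbhd G v)}) := by
    intro A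
    have : ∀ v, choiceWeight G d v A ^ (d : ℝ)⁻¹ = if Disjoint A (nbhd G v) then 2 else 1 := by
      intro v
      unfold choiceWeight
      split_ifs
      · exact Real.pow_rpow_inv_natCast (by norm_num) hd
      · exact Real.one_rpow _
    simp_rw [this]
    simp [prod_ite]
  simp_rw [h]
  rw [← Nat.cast_sum, ← card_sigma]
  congr 1
  refine card_bij' (fun p _ => ⟨p.1, p.2⟩) (fun p _ => (p.1, p.2)) ?_ ?_ ?_ ?_
  · rintro ⟨A, B⟩ hp
    simp only [mem_filter, mem_univ, true_and] at hp
    simp only [mem_sigma, mem_univ, mem_powerset, true_and]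
    intro v hv
    simp only [mem_filter, mem_univ, true_and, disjoint_left, mem_nbhd]
    exact fun u hu h => hp u hu v hv h.symm
  · rintro ⟨A, B⟩ hp
    simp only [mem_sigma, mem_univ, mem_powerset, true_and] at hp
    simp only [mem_filter, mem_univ, true_and]
    intro u hu v hv h
    have := hp hv
    simp only [mem_filter, mem_univ, true_and, disjoint_left, mem_nbhd] at this
    exact this hu h.symm
  · intros; rfl
  · intros; rfl

theorem prod_const_rpow (hd : d ≠ 0) :
    ∏ _v : V, ((2 : ℝ) ^ (d + 1) - 1) ^ (d : ℝ)⁻¹ =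
      (((2 : ℝ) ^ (d + 1) - 1) ^ ((Fintype.card V : ℝ) / (2 * d))) ^ 2 := by
  have h0 : (0 : ℝ) ≤ 2 ^ (d + 1) - 1 := sub_nonneg.2 (one_le_pow₀ (by norm_num))
  rw [prod_const, card_univ, ← Real.rpow_mul_natCast h0, ← Real.rpow_mul_natCast h0]
  congr 1
  push_cast
  field_simp

theorem numIndepSets_le (hd : d ≠ 0) (hreg : G.IsRegularOfDegree d) :
    (numIndepSets G : ℝ) ≤ ((2 : ℝ) ^ (d + 1) - 1) ^ ((Fintype.card V : ℝ) / (2 * d)) := by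
  have h0 : (0 : ℝ) ≤ 2 ^ (d + 1) - 1 := sub_nonneg.2 (one_le_pow₀ (by norm_num))
  refine le_of_sq_le_sq ?_ (Real.rpow_nonneg h0 _)
  have hF := sum_powerset_prod_rpow_le_s3 hd (card_filter_mem_nbhd hreg) univ
    (choiceWeight_pos (G := G) (d := d)) choiceWeight_inter
  simp only [powerset_univ, univ_inter, sum_choiceWeight hreg] at hF
  rw [← card_pairs_eq_sum hd, prod_const_rpow hd] at hF
  exact le_trans (mod_cast numIndepSets_sq_le_s3 G) hF

theorem numIndepSets_lt (hd : d ≠ 0) (hreg : G.IsRegularOfDegree d) {a b u w : V}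
    (hau : G.Adj a u) (hbu : G.Adj b u) (haw : G.Adj a w) (hbw : ¬ G.Adj b w) :
    (numIndepSets G : ℝ) < ((2 : ℝ) ^ (d + 1) - 1) ^ ((Fintype.card V : ℝ) / (2 * d)) := by
  have h0 : (0 : ℝ) ≤ 2 ^ (d + 1) - 1 := sub_nonneg.2 (one_le_pow₀ (by norm_num))
  refine lt_of_pow_lt_pow_left₀ 2 (Real.rpow_nonneg h0 _) ?_
  have huw : u ≠ w := fun h => hbw (h ▸ hbu)
  have h2 : (1 : ℝ) < 2 ^ d := one_lt_pow₀ (by norm_num) hd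
  have hF := sum_prod_rpow_lt hd (card_filter_mem_nbhd hreg)
    (choiceWeight_pos (G := G) (d := d)) choiceWeight_inter (A := {w}) (u := u) (j := a) (k := b)
    (by simpa using huw) (mem_nbhd.2 hau) (mem_nbhd.2 hbu)
    (by simpa [choiceWeight, mem_nbhd, hau, hbu, haw, hbw] using h2.ne)
  simp only [sum_choiceWeight hreg] at hF
  rw [← card_pairs_eq_sum hd, prod_const_rpow hd] at hF
  exact lt_of_le_of_lt (mod_cast numIndepSets_sq_le_s3 G) hF

end IndependentSets

section Equality

variable {V : Type*} {d : ℕ}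

/-- A graph in which the two sides of a predicate have size `d`, and adjacency means lying on
different sides, is `K_{d,d}`. -/
theorem nonempty_iso_completeBipartiteGraph {X : Type*} [Fintype X] {H : SimpleGraph X}
    (p : X → Prop) (hp : Fintype.card {x // p x} = d) (hq : Fintype.card {x // ¬ p x} = d)
    (hH : ∀ x y, H.Adj x y ↔ (p x ↔ ¬ p y)) :
    Nonempty (H ≃g completeBipartiteGraph (Fin d) (Fin d)) := by
  refine ⟨⟨(Equiv.sumCompl p).symm.trans
    (Equiv.sumCongr (Fintype.equivFinOfCardEq hp) (Fintype.equivFinOfCardEq hq)), ?_⟩⟩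
  intro x y
  rw [hH]
  by_cases hx : p x <;> by_cases hy : p y <;>
    simp [hx, hy, completeBipartiteGraph]

theorem isDisjUnionKdd_of_common_neighbor [Fintype V] {G : SimpleGraph V} (hd : d ≠ 0)
    (hreg : G.IsRegularOfDegree d)
    (h : ∀ a b u w, G.Adj a u → G.Adj b u → G.Adj a w → G.Adj b w) :
    IsDisjUnionKdd G d := by
  intro C
  induction C using SimpleGraph.ConnectedComponent.ind with | _ u
  obtain ⟨w, hw⟩ := card_pos.1 ((card_nbhd hreg u).symm ▸ Nat.pos_of_ne_zero hd)
  rw [mem_nbhd] at hw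
  have hN : ∀ {x y}, G.Adj u x → (G.Adj x y ↔ G.Adj w y) := fun {x y} hx =>
    ⟨h x w u y hx.symm hw.symm, h w x u y hw.symm hx.symm⟩
  have hM : ∀ {x y}, G.Adj w x → (G.Adj x y ↔ G.Adj u y) := fun {x y} hx =>
    ⟨h x u w y hx.symm hw, h u x w y hw hx.symm⟩
  have hdisj : ∀ x, G.Adj u x → ¬ G.Adj w x := fun x hx hx' =>
    G.irrefl (h w u x u hx' hx hw.symm)
  have hmem : ∀ x, G.connectedComponentMk x = G.connectedComponentMk u ↔
      G.Adj u x ∨ G.Adj w x := by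
    intro x
    constructor
    · intro hx
      obtain ⟨q⟩ := (SimpleGraph.ConnectedComponent.eq.1 hx).symm
      have : ∀ a b, G.Walk a b → (G.Adj u a ∨ G.Adj w a) → (G.Adj u b ∨ G.Adj w b) := by
        intro a b q
        induction q with
        | nil => exact id
        | cons hab _ ih =>
          exact fun ha => ih (ha.elim (fun ha => .inr ((hN ha).1 hab))
            (fun ha => .inl ((hM ha).1 hab)))
      exact this u x q (.inr hw.symm)
    · rintro (hx | hx)
      · exact SimpleGraph.ConnectedComponent.eq.2 hx.symm.reachable
      · exact SimpleGraph.ConnectedComponent.eq.2 (hx.symm.reachable.trans hw.symm.reachable)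
  have hcard : ∀ (v : V) (p : {x | G.connectedComponentMk x = G.connectedComponentMk u} → Prop),
      (∀ x, p x ↔ G.Adj v x) →
      (∀ x, G.Adj v x → G.connectedComponentMk x = G.connectedComponentMk u) →
      Fintype.card {x // p x} = d := by
    intro v p hp hv
    rw [← card_nbhd hreg v, ← Fintype.card_coe]
    exact Fintype.card_congr
      { toFun := fun x => ⟨x.1.1, mem_nbhd.2 ((hp _).1 x.2)⟩
        invFun := fun x => ⟨⟨x.1, hv _ (mem_nbhd.1 x.2)⟩, (hp _).2 (mem_nbhd.1 x.2)⟩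
        left_inv := fun _ => rfl
        right_inv := fun _ => rfl }
  have hnot : ∀ x, G.connectedComponentMk x = G.connectedComponentMk u →
      (¬ G.Adj u x ↔ G.Adj w x) := fun x hx =>
    ⟨((hmem x).1 hx).resolve_left, fun h1 h2 => hdisj x h2 h1⟩
  refine nonempty_iso_completeBipartiteGraph (fun x => G.Adj u x)
    (hcard u _ (fun _ => Iff.rfl) fun x hx => (hmem x).2 (.inl hx))
    (by convert hcard w _ (fun x => hnot x x.2) fun x hx => (hmem x).2 (.inr hx)) ?_
  rintro ⟨x, hx⟩ ⟨y, hy⟩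
  rw [SimpleGraph.comap_adj]
  change G.Adj x y ↔ (G.Adj u x ↔ ¬ G.Adj u y)
  rw [hnot y hy]
  by_cases hux : G.Adj u x
  · simp [hux, hN hux]
  · rw [hM ((hnot x hx).1 hux), ← hnot y hy]
    tauto

theorem two_pow_sub_one_le_numIndepSets {X : Type*} [Fintype X] {H : SimpleGraph X}
    (e : H ≃g completeBipartiteGraph (Fin d) (Fin d)) :
    2 ^ (d + 1) - 1 ≤ numIndepSets H := by
  let L : Finset (Fin d ⊕ Fin d) := univ.map Function.Embedding.inl
  let R : Finset (Fin d ⊕ Fin d) := univ.map Function.Embedding.inr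
  have hL : #L = d := by simp [L]
  have hR : #R = d := by simp [R]
  have hLR : L.powerset ∩ R.powerset = {∅} := by
    have : L ∩ R = ∅ := by
      ext (x | x) <;> simp [L, R]
    ext S
    rw [mem_inter, mem_powerset, mem_powerset, ← subset_inter_iff, this, subset_empty,
      mem_singleton]
  have hcard : #(L.powerset ∪ R.powerset) = 2 ^ (d + 1) - 1 := by
    have h := card_union_add_card_inter L.powerset R.powerset
    simp only [hLR, card_powerset, hL, hR, card_singleton] at h
    rw [pow_succ]
    omega
  rw [← hcard, numIndepSets]
  refine card_le_card_of_injOn (fun S => S.map e.symm.toEquiv.toEmbedding) ?_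
    (map_injective _).injOn
  intro S hS
  simp only [coe_filter, Set.mem_ofPred_eq, mem_univ, true_and, mem_map]
  rintro _ ⟨x, hx, rfl⟩ _ ⟨y, hy, rfl⟩ hxy
  have hxy' : (completeBipartiteGraph (Fin d) (Fin d)).Adj x y := e.symm.map_adj_iff.1 hxy
  rcases mem_union.1 (mem_coe.1 hS) with hS | hS
  · have h1 := mem_powerset.1 hS hx
    have h2 := mem_powerset.1 hS hy
    rcases x with x | x <;> rcases y with y | y <;> simp_all [L, completeBipartiteGraph]
  · have h1 := mem_powerset.1 hS hx
    have h2 := mem_powerset.1 hS hy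
    rcases x with x | x <;> rcases y with y | y <;> simp_all [R, completeBipartiteGraph]

theorem prod_numIndepSets_le [Fintype V] (G : SimpleGraph V) :
    ∏ C : G.ConnectedComponent, numIndepSets (G.induce {v | G.connectedComponentMk v = C}) ≤
      numIndepSets G := by
  simp only [numIndepSets]
  rw [← Fintype.card_piFinset]
  refine card_le_card_of_injOn
    (fun S => ({v | ⟨v, rfl⟩ ∈ S (G.connectedComponentMk v)} : Finset V)) ?_ ?_
  · intro S hS
    simp only [Fintype.coe_piFinset, Set.mem_pi, Set.mem_univ, coe_filter, mem_univ, true_and,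
      Set.mem_ofPred_eq, forall_const, mem_filter] at hS ⊢
    intro u hu v hv huv
    have huv' : G.connectedComponentMk v = G.connectedComponentMk u :=
      SimpleGraph.ConnectedComponent.eq.2 huv.symm.reachable
    have hv' : (⟨v, huv'⟩ : {x | G.connectedComponentMk x = G.connectedComponentMk u}) ∈
        S (G.connectedComponentMk u) := by
      clear hS hu
      revert huv'
      generalize G.connectedComponentMk u = C
      rintro rfl
      exact hv
    exact hS _ _ hu _ hv' huv
  · intro S _ T _ hST
    funext C
    ext ⟨v, rfl⟩
    simpa using Finset.ext_iff.1 hST v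

theorem le_numIndepSets_of_isDisjUnionKdd [Fintype V] {G : SimpleGraph V} (hd : d ≠ 0)
    (h : IsDisjUnionKdd G d) :
    ((2 : ℝ) ^ (d + 1) - 1) ^ ((Fintype.card V : ℝ) / (2 * d)) ≤ numIndepSets G := by
  have hcard : Fintype.card V = Fintype.card G.ConnectedComponent * (2 * d) := by
    rw [← Fintype.card_congr (Equiv.sigmaFiberEquiv G.connectedComponentMk), Fintype.card_sigma]
    have : ∀ C : G.ConnectedComponent,
        Fintype.card {v // G.connectedComponentMk v = C} = 2 * d := fun C => by
      obtain ⟨e⟩ := h C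
      rw [two_mul]
      exact (Fintype.card_congr e.toEquiv).trans (by simp)
    simp [this]
  have hexp : (Fintype.card V : ℝ) / (2 * d) = Fintype.card G.ConnectedComponent := by
    rw [hcard]
    push_cast
    field_simp
  have hle : (2 ^ (d + 1) - 1) ^ Fintype.card G.ConnectedComponent ≤ numIndepSets G := by
    refine le_trans ?_ (prod_numIndepSets_le G)
    rw [← card_univ, ← prod_const]
    exact prod_le_prod' fun C _ => two_pow_sub_one_le_numIndepSets (h C).some
  rw [hexp, Real.rpow_natCast]
  have := (Nat.cast_le (α := ℝ)).2 hle
  rwa [Nat.cast_pow, Nat.cast_sub Nat.one_le_two_pow, Nat.cast_pow, Nat.cast_ofNat,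
    Nat.cast_one] at this

end Equality

/-- **Zhao.** If `G` is a `d`-regular graph on `n` vertices (`d ≥ 1`), then
`i(G) ≤ (2^{d+1} - 1)^{n/(2d)}`, with equality iff `G` is a disjoint union of
copies of `K_{d,d}`. -/
theorem zhao_regular {V : Type*} [Fintype V] (G : SimpleGraph V) (d n : ℕ)
    (hd : 1 ≤ d) (hn : Fintype.card V = n) (hreg : G.IsRegularOfDegree d) :
    (numIndepSets G : ℝ) ≤ ((2:ℝ) ^ (d + 1) - 1) ^ ((n : ℝ) / (2 * d)) ∧
      ((numIndepSets G : ℝ) = ((2:ℝ) ^ (d + 1) - 1) ^ ((n : ℝ) / (2 * d)) ↔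
        IsDisjUnionKdd G d) := by
  subst hn
  have hd0 : d ≠ 0 := Nat.one_le_iff_ne_zero.1 hd
  refine ⟨numIndepSets_le hd0 hreg, fun heq => ?_, fun h =>
    (numIndepSets_le hd0 hreg).antisymm (le_numIndepSets_of_isDisjUnionKdd hd0 h)⟩
  refine isDisjUnionKdd_of_common_neighbor hd0 hreg fun a b u w hau hbu haw => ?_
  by_contra hbw
  exact (numIndepSets_lt hd0 hreg hau hbu haw hbw).ne heq
end
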